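/- Let x: U → ℝ³ be a smooth immersed surface with unit normal N and let f(p,t) = (x(p), t·N(p)) be the associated normal bundle immersion of U × ℝ into ℂ³ = ℝ³ × ℝ³. Then f is a Maslovian Lagrangian immersion if and only if x(U) is contained in a round sphere, a circular cylinder, or a circular cone. -/

import Mathlib

noncomputable section

open scoped InnerProductSpace

/-- Euclidean 3-space. -/
abbrev E3 : Type := EuclideanSpace ℝ (Fin 3)

/-- ℝ⁶ = ℝ³ × ℝ³, identified with ℂ³. -/
abbrev V6 : Type := E3 × E3

/-- The domain of the normal bundle immersion: ℝ² × ℝ. -/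
abbrev W3 : Type := (ℝ × ℝ) × ℝ

/-- The standard inner product on ℝ⁶ = ℝ³ × ℝ³. -/
def ip6 (v w : V6) : ℝ := ⟪v.1, w.1⟫_ℝ + ⟪v.2, w.2⟫_ℝ

/-- The complex structure J(X, Y) = (−Y, X) on ℝ³ × ℝ³ = ℂ³. -/
def Jc (v : V6) : V6 := (-v.2, v.1)

/-- The normal bundle immersion f(p, t) = (x(p), t·N(p)). -/
def nbi (x N : ℝ × ℝ → E3) : W3 → V6 := fun q => (x q.1, q.2 • N q.1)

/-- Second derivative of `g` at `q` in directions `v`, `w`. -/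
def d2 (g : W3 → V6) (q v w : W3) : V6 := fderiv ℝ (fun y => fderiv ℝ g y w) q v

/-- `n` is orthogonal to the tangent space (range of the differential) of `g` at `q`. -/
def IsNormalAt (g : W3 → V6) (q : W3) (n : V6) : Prop :=
  ∀ v : W3, ip6 n (fderiv ℝ g q v) = 0

/-- `n` is the second fundamental form `h(v, w)` of `g` at `q`: the orthogonal projection of
the second derivative in directions `v`, `w` onto the orthogonal complement of the tangent
space. -/
def IsSFF (g : W3 → V6) (q v w : W3) (n : V6) : Prop :=
  IsNormalAt g q n ∧ d2 g q v w - n ∈ Set.range ⇑(fderiv ℝ g q)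

/-- `v₁, v₂, v₃` is an orthonormal frame at `q` for the metric induced by `g`. -/
def ONFrame (g : W3 → V6) (q : W3) (v₁ v₂ v₃ : W3) : Prop :=
  ip6 (fderiv ℝ g q v₁) (fderiv ℝ g q v₁) = 1 ∧
  ip6 (fderiv ℝ g q v₂) (fderiv ℝ g q v₂) = 1 ∧
  ip6 (fderiv ℝ g q v₃) (fderiv ℝ g q v₃) = 1 ∧
  ip6 (fderiv ℝ g q v₁) (fderiv ℝ g q v₂) = 0 ∧
  ip6 (fderiv ℝ g q v₁) (fderiv ℝ g q v₃) = 0 ∧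
  ip6 (fderiv ℝ g q v₂) (fderiv ℝ g q v₃) = 0

/-- `Hq` is the mean curvature vector of `g` at `q`:
`H = Σᵢ h(ẽᵢ, ẽᵢ)` for an orthonormal frame `ẽ₁, ẽ₂, ẽ₃` of the induced metric. -/
def IsMeanCurvAt (g : W3 → V6) (q : W3) (Hq : V6) : Prop :=
  ∃ v₁ v₂ v₃ : W3, ONFrame g q v₁ v₂ v₃ ∧
    ∃ n₁ n₂ n₃ : V6, IsSFF g q v₁ v₁ n₁ ∧ IsSFF g q v₂ v₂ n₂ ∧ IsSFF g q v₃ v₃ n₃ ∧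
      Hq = n₁ + n₂ + n₃

/-- `u = A_ξ v`, the shape operator of `g` at `q` with respect to the normal vector `ξ`,
characterized by `⟨dg(A_ξ v), dg(w)⟩ = ⟨h(v, w), ξ⟩` for all `w`. -/
def IsShapeAt (g : W3 → V6) (q : W3) (ξ : V6) (v u : W3) : Prop :=
  ∀ w : W3, ∀ n : V6, IsSFF g q v w n →
    ip6 (fderiv ℝ g q u) (fderiv ℝ g q w) = ip6 n ξ

/-- `g` is a Lagrangian immersion at `q`: the differential is injective and `J` maps the
tangent space onto its orthogonal complement. -/
def LagrangianAt (g : W3 → V6) (q : W3) : Prop :=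
  Function.Injective ⇑(fderiv ℝ g q) ∧
    Jc '' Set.range ⇑(fderiv ℝ g q) =
      {u : V6 | ∀ w ∈ Set.range ⇑(fderiv ℝ g q), ip6 u w = 0}

/-- The Maslovian condition at `q` for the mean curvature vector `Hq`: `Hq ≠ 0` and
`A_H(JH)` is a real scalar multiple of `JH` (expressed via the tangent vector `V`
with `dg(V) = J Hq`). -/
def MaslovianAt (g : W3 → V6) (q : W3) (Hq : V6) : Prop :=
  Hq ≠ 0 ∧ ∀ V u : W3, fderiv ℝ g q V = Jc Hq → IsShapeAt g q Hq V u → ∃ c : ℝ, u = c • V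

/-- Standard hypotheses: `U` is a connected open set, `x` is a smooth immersion on `U`, and
`N` is a smooth unit normal field along `x` on `U`. -/
structure SurfaceData (U : Set (ℝ × ℝ)) (x N : ℝ × ℝ → E3) : Prop where
  open_U : IsOpen U
  conn_U : IsConnected U
  smooth_x : ContDiffOn ℝ (⊤ : ℕ∞) x U
  smooth_N : ContDiffOn ℝ (⊤ : ℕ∞) N U
  immersion : ∀ p ∈ U, Function.Injective ⇑(fderiv ℝ x p)
  unit_N : ∀ p ∈ U, ‖N p‖ = 1
  normal_N : ∀ p ∈ U, ∀ v : ℝ × ℝ, ⟪N p, fderiv ℝ x p v⟫_ℝ = 0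

/-- `x` is minimal at `p`: the trace of the shape operator `A = −dN ∘ dx⁻¹` vanishes,
expressed via orthonormal frames of the induced metric. -/
def SurfMinimalAt (x N : ℝ × ℝ → E3) (p : ℝ × ℝ) : Prop :=
  ∀ v₁ v₂ : ℝ × ℝ,
    ⟪fderiv ℝ x p v₁, fderiv ℝ x p v₁⟫_ℝ = 1 →
    ⟪fderiv ℝ x p v₂, fderiv ℝ x p v₂⟫_ℝ = 1 →
    ⟪fderiv ℝ x p v₁, fderiv ℝ x p v₂⟫_ℝ = 0 →
    ⟪fderiv ℝ N p v₁, fderiv ℝ x p v₁⟫_ℝ + ⟪fderiv ℝ N p v₂, fderiv ℝ x p v₂⟫_ℝ = 0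

/-- A rigid motion of ℝ³: `y ↦ S y + c` with `S ∈ SO(3)`. -/
def RigidMotion (Φ : E3 → E3) : Prop :=
  ∃ (S : E3 ≃ₗᵢ[ℝ] E3) (c : E3),
    LinearMap.det (S.toLinearEquiv : E3 →ₗ[ℝ] E3) = 1 ∧ ∀ y, Φ y = S y + c

/-- The circular cone `C_r = {(s·r·cos θ, s·r·sin θ, s)/√(r²+1) : s > 0, θ ∈ ℝ}`. -/
def coneSet (r : ℝ) : Set E3 :=
  { y | ∃ s θ : ℝ, 0 < s ∧
      y 0 = s * r * Real.cos θ / Real.sqrt (r ^ 2 + 1) ∧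
      y 1 = s * r * Real.sin θ / Real.sqrt (r ^ 2 + 1) ∧
      y 2 = s / Real.sqrt (r ^ 2 + 1) }

/-- `x(U)` is contained in a round sphere. -/
def InRoundSphere (U : Set (ℝ × ℝ)) (x : ℝ × ℝ → E3) : Prop :=
  ∃ (c : E3) (ρ : ℝ), 0 < ρ ∧ ∀ p ∈ U, ‖x p - c‖ = ρ

/-- `x(U)` is contained in a circular cylinder. -/
def InCircularCylinder (U : Set (ℝ × ℝ)) (x : ℝ × ℝ → E3) : Prop :=
  ∃ (c w : E3) (ρ : ℝ), ‖w‖ = 1 ∧ 0 < ρ ∧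
    ∀ p ∈ U, ‖(x p - c) - ⟪x p - c, w⟫_ℝ • w‖ = ρ

/-- `x(U)` is contained in a circular cone: the image under a rigid motion of `C_r`, `r ≠ 0`. -/
def InCircularCone (U : Set (ℝ × ℝ)) (x : ℝ × ℝ → E3) : Prop :=
  ∃ r : ℝ, r ≠ 0 ∧ ∃ Φ : E3 → E3, RigidMotion Φ ∧ ∀ p ∈ U, x p ∈ Φ '' coneSet r

section LagrangianFrames

lemma ip6_comm (a b : V6) : ip6 a b = ip6 b a := by
  simp only [ip6, real_inner_comm]

lemma ip6_add_left (a b c : V6) : ip6 (a + b) c = ip6 a c + ip6 b c := by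
  simp only [ip6, Prod.fst_add, Prod.snd_add, inner_add_left]; ring

lemma ip6_smul_left (r : ℝ) (a b : V6) : ip6 (r • a) b = r * ip6 a b := by
  simp only [ip6, Prod.smul_fst, Prod.smul_snd, real_inner_smul_left]; ring

/-- The inner product of `ℝ⁶` as a bilinear form. -/
def ip6Form : V6 →ₗ[ℝ] V6 →ₗ[ℝ] ℝ :=
  LinearMap.mk₂ ℝ ip6 ip6_add_left ip6_smul_left
    (fun a b c => by rw [ip6_comm, ip6_add_left, ip6_comm b, ip6_comm c])
    (fun r a b => by rw [ip6_comm, ip6_smul_left, ip6_comm b]; rfl)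

lemma ip6Form_apply (a b : V6) : ip6Form a b = ip6 a b := rfl

lemma ip6_sum_left {ι : Type*} (s : Finset ι) (f : ι → V6) (b : V6) :
    ip6 (∑ i ∈ s, f i) b = ∑ i ∈ s, ip6 (f i) b := by
  rw [← ip6Form_apply, map_sum, LinearMap.sum_apply]
  rfl

lemma ip6_sub_left (a b c : V6) : ip6 (a - b) c = ip6 a c - ip6 b c := by
  rw [← ip6Form_apply, map_sub, LinearMap.sub_apply]
  rfl

lemma ip6_neg_left (a b : V6) : ip6 (-a) b = -ip6 a b := by
  rw [← ip6Form_apply, map_neg, LinearMap.neg_apply]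
  rfl

/-- The complex structure as a linear map. -/
def JcLin : V6 →ₗ[ℝ] V6 where
  toFun := Jc
  map_add' a b := by simp [Jc, add_comm]
  map_smul' r a := by simp [Jc]

lemma JcLin_apply (a : V6) : JcLin a = Jc a := rfl

lemma Jc_Jc (a : V6) : Jc (Jc a) = -a := rfl

lemma ip6_Jc_Jc (a b : V6) : ip6 (Jc a) (Jc b) = ip6 a b := by
  simp only [ip6, Jc, inner_neg_neg]; ring

/-- A unitary frame and its rotation by `J` span `ℝ⁶`. -/
lemma eq_zero_of_ip6_frame {b : Fin 3 → V6}
    (hb : ∀ i j, ip6 (b i) (b j) = if i = j then 1 else 0)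
    (hJ : ∀ i j, ip6 (b i) (Jc (b j)) = 0) {z : V6}
    (h1 : ∀ i, ip6 z (b i) = 0) (h2 : ∀ i, ip6 z (Jc (b i)) = 0) : z = 0 := by
  let w : Fin 3 ⊕ Fin 3 → WithLp 2 (E3 × E3) :=
    Sum.elim (fun i => WithLp.toLp 2 (b i)) (fun i => WithLp.toLp 2 (Jc (b i)))
  have hw : Orthonormal ℝ w := by
    rw [orthonormal_iff_ite]
    rintro (i | i) (j | j)
    · simpa [w, WithLp.prod_inner_apply, ip6] using hb i j
    · simpa [w, WithLp.prod_inner_apply, ip6] using hJ i j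
    · have := hJ j i
      rw [ip6_comm] at this
      simpa [w, WithLp.prod_inner_apply, ip6] using this
    · have := (ip6_Jc_Jc (b i) (b j)).trans (hb i j)
      simpa [w, WithLp.prod_inner_apply, ip6] using this
  have hspan := hw.linearIndependent.span_eq_top_of_card_eq_finrank' (by
    have : Module.finrank ℝ (WithLp 2 (E3 × E3)) = Module.finrank ℝ (E3 × E3) :=
      (WithLp.linearEquiv 2 ℝ (E3 × E3)).finrank_eq
    rw [this]; simp)
  have hz : WithLp.toLp 2 z ∈ (Submodule.span ℝ (Set.range w))ᗮ := by
    rw [Submodule.mem_orthogonal']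
    intro u hu
    induction hu using Submodule.span_induction with
    | mem u hu =>
      obtain ⟨i | i, rfl⟩ := hu
      · simpa [w, WithLp.prod_inner_apply, ip6] using h1 i
      · simpa [w, WithLp.prod_inner_apply, ip6] using h2 i
    | zero => simp
    | add x y _ _ hx hy => rw [inner_add_right, hx, hy, add_zero]
    | smul r x _ hx => rw [inner_smul_right, hx, mul_zero]
  rw [hspan, Submodule.top_orthogonal_eq_bot, Submodule.mem_bot] at hz
  exact congrArg WithLp.ofLp hz

/-- An orthonormal frame `v` of the metric induced by a Lagrangian immersion `g` at `q`, where the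
second derivative of `g` is the bilinear map `Q`. -/
structure LagrFrame (g : W3 → V6) (q : W3) (Q : W3 →ₗ[ℝ] W3 →ₗ[ℝ] V6) (v : Fin 3 → W3) :
    Prop where
  d2_eq : ∀ a b, d2 g q a b = Q a b
  inj : Function.Injective (fderiv ℝ g q)
  orth : ∀ i j, ip6 (fderiv ℝ g q (v i)) (fderiv ℝ g q (v j)) = if i = j then 1 else 0
  lagr : ∀ a b, ip6 (fderiv ℝ g q a) (Jc (fderiv ℝ g q b)) = 0

namespace LagrFrame

variable {g : W3 → V6} {q : W3} {Q : W3 →ₗ[ℝ] W3 →ₗ[ℝ] V6} {v : Fin 3 → W3}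

lemma ext_ip6 (h : LagrFrame g q Q v) {y z : V6}
    (h1 : ∀ i, ip6 y (fderiv ℝ g q (v i)) = ip6 z (fderiv ℝ g q (v i)))
    (h2 : ∀ i, ip6 y (Jc (fderiv ℝ g q (v i))) = ip6 z (Jc (fderiv ℝ g q (v i)))) : y = z := by
  rw [← sub_eq_zero]
  refine eq_zero_of_ip6_frame h.orth (fun i j => h.lagr _ _) (fun i => ?_) (fun i => ?_)
  · rw [ip6_sub_left, h1, sub_self]
  · rw [ip6_sub_left, h2, sub_self]

lemma ip6_sum_tangent (h : LagrFrame g q Q v) (c : Fin 3 → ℝ) (j : Fin 3) :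
    ip6 (∑ i, c i • fderiv ℝ g q (v i)) (fderiv ℝ g q (v j)) = c j := by
  rw [ip6_sum_left]
  simp [ip6_smul_left, h.orth]

lemma ip6_sum_normal (h : LagrFrame g q Q v) (c : Fin 3 → ℝ) (j : Fin 3) :
    ip6 (∑ i, c i • Jc (fderiv ℝ g q (v i))) (Jc (fderiv ℝ g q (v j))) = c j := by
  rw [ip6_sum_left]
  simp [ip6_smul_left, h.orth, ip6_Jc_Jc]

lemma ip6_sum_normal_tangent (h : LagrFrame g q Q v) (c : Fin 3 → ℝ) (w : W3) :
    ip6 (∑ i, c i • Jc (fderiv ℝ g q (v i))) (fderiv ℝ g q w) = 0 := by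
  rw [ip6_sum_left]
  simp [ip6_smul_left, ip6_comm (Jc _), h.lagr]

lemma ip6_sum_tangent_normal (h : LagrFrame g q Q v) (c : Fin 3 → ℝ) (w : W3) :
    ip6 (∑ i, c i • fderiv ℝ g q (v i)) (Jc (fderiv ℝ g q w)) = 0 := by
  rw [ip6_sum_left]
  simp [ip6_smul_left, h.lagr]

lemma eq_sum (h : LagrFrame g q Q v) (w : W3) :
    w = ∑ i, ip6 (fderiv ℝ g q w) (fderiv ℝ g q (v i)) • v i := by
  apply h.inj
  rw [map_sum]
  simp only [map_smul]
  refine h.ext_ip6 (fun i => ?_) (fun i => ?_)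
  · rw [h.ip6_sum_tangent]
  · rw [h.ip6_sum_tangent_normal, h.lagr]

lemma isSFF_iff (h : LagrFrame g q Q v) (a b : W3) (n : V6) :
    IsSFF g q a b n ↔
      n = ∑ k, ip6 (Q a b) (Jc (fderiv ℝ g q (v k))) • Jc (fderiv ℝ g q (v k)) := by
  constructor
  · rintro ⟨hn, s, hs⟩
    refine h.ext_ip6 (fun i => ?_) (fun i => ?_)
    · rw [h.ip6_sum_normal_tangent, hn]
    · rw [h.ip6_sum_normal]
      have := h.lagr s (v i)
      rw [hs, ip6_sub_left, h.d2_eq] at this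
      linarith
  · rintro rfl
    refine ⟨fun w => h.ip6_sum_normal_tangent _ _,
      ∑ i, ip6 (Q a b) (fderiv ℝ g q (v i)) • v i, ?_⟩
    rw [map_sum, h.d2_eq]
    simp only [map_smul]
    refine h.ext_ip6 (fun i => ?_) (fun i => ?_)
    · rw [h.ip6_sum_tangent, ip6_sub_left, h.ip6_sum_normal_tangent, sub_zero]
    · rw [h.ip6_sum_tangent_normal, ip6_sub_left, h.ip6_sum_normal, sub_self]

/-- The trace of a bilinear map does not depend on the orthonormal frame. -/
lemma trace_eq (h : LagrFrame g q Q v) {w : Fin 3 → W3}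
    (hw : ∀ i j, ip6 (fderiv ℝ g q (w i)) (fderiv ℝ g q (w j)) = if i = j then 1 else 0) :
    ∑ i, Q (w i) (w i) = ∑ i, Q (v i) (v i) := by
  set O : Matrix (Fin 3) (Fin 3) ℝ :=
    Matrix.of fun i j => ip6 (fderiv ℝ g q (w i)) (fderiv ℝ g q (v j)) with hO
  have hwi : ∀ i, w i = ∑ j, O i j • v j := fun i => h.eq_sum (w i)
  have h1 : O * O.transpose = 1 := by
    ext i j
    rw [Matrix.mul_apply, Matrix.one_apply, ← hw i j]
    conv_rhs => rw [hwi i, map_sum, ip6_sum_left]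
    refine Finset.sum_congr rfl fun k _ => ?_
    rw [map_smul, ip6_smul_left, ip6_comm (fderiv ℝ g q (v k))]
    rfl
  have h2 : ∀ j l, ∑ i, O i j * O i l = if j = l then 1 else 0 := by
    intro j l
    have h3 : O.transpose * O = 1 := mul_eq_one_comm.1 h1
    have := congrFun (congrFun h3 j) l
    simpa [Matrix.mul_apply, Matrix.one_apply] using this
  calc ∑ i, Q (w i) (w i) = ∑ i, ∑ j, ∑ l, (O i j * O i l) • Q (v j) (v l) := by
        refine Finset.sum_congr rfl fun i _ => ?_
        conv_lhs => rw [hwi i]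
        simp only [map_sum, LinearMap.sum_apply, map_smul, LinearMap.smul_apply, Finset.smul_sum,
          smul_smul]
        rw [Finset.sum_comm]
        exact Finset.sum_congr rfl fun j _ => Finset.sum_congr rfl fun l _ => by rw [mul_comm]
    _ = ∑ j, ∑ l, (∑ i, O i j * O i l) • Q (v j) (v l) := by
        rw [Finset.sum_comm]
        refine Finset.sum_congr rfl fun j _ => ?_
        rw [Finset.sum_comm]
        exact Finset.sum_congr rfl fun l _ => by rw [Finset.sum_smul]
    _ = ∑ i, Q (v i) (v i) := by simp [h2]

lemma isMeanCurvAt_iff (h : LagrFrame g q Q v) (H : V6) :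
    IsMeanCurvAt g q H ↔
      H = ∑ k, (∑ i, ip6 (Q (v i) (v i)) (Jc (fderiv ℝ g q (v k)))) •
        Jc (fderiv ℝ g q (v k)) := by
  have key : ∀ w : Fin 3 → W3,
      ∑ i, ∑ k, ip6 (Q (w i) (w i)) (Jc (fderiv ℝ g q (v k))) • Jc (fderiv ℝ g q (v k)) =
      ∑ k, ip6 (∑ i, Q (w i) (w i)) (Jc (fderiv ℝ g q (v k))) • Jc (fderiv ℝ g q (v k)) := by
    intro w
    rw [Finset.sum_comm]
    refine Finset.sum_congr rfl fun k _ => ?_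
    rw [← Finset.sum_smul, ip6_sum_left]
  have key' : ∑ k, (∑ i, ip6 (Q (v i) (v i)) (Jc (fderiv ℝ g q (v k)))) •
        Jc (fderiv ℝ g q (v k)) =
      ∑ k, ip6 (∑ i, Q (v i) (v i)) (Jc (fderiv ℝ g q (v k))) • Jc (fderiv ℝ g q (v k)) := by
    rw [← key, Finset.sum_comm]
    exact Finset.sum_congr rfl fun k _ => by rw [Finset.sum_smul]
  rw [key']
  constructor
  · rintro ⟨w₁, w₂, w₃, ⟨h11, h22, h33, h12, h13, h23⟩, n₁, n₂, n₃, hn₁, hn₂, hn₃, rfl⟩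
    rw [h.isSFF_iff] at hn₁ hn₂ hn₃
    have hw : ∀ i j, ip6 (fderiv ℝ g q (![w₁, w₂, w₃] i)) (fderiv ℝ g q (![w₁, w₂, w₃] j)) =
        if i = j then 1 else 0 := by
      intro i j
      fin_cases i <;> fin_cases j <;>
        simp [h11, h22, h33, h12, h13, h23, ip6_comm (fderiv ℝ g q w₂) (fderiv ℝ g q w₁),
          ip6_comm (fderiv ℝ g q w₃)]
    rw [← h.trace_eq hw, ← key, Fin.sum_univ_three, hn₁, hn₂, hn₃]
    rfl
  · intro hH
    refine ⟨v 0, v 1, v 2, ?_, _, _, _, (h.isSFF_iff _ _ _).2 rfl, (h.isSFF_iff _ _ _).2 rfl,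
      (h.isSFF_iff _ _ _).2 rfl, ?_⟩
    · simp [ONFrame, h.orth]
    · rw [hH, ← key, Fin.sum_univ_three]

/-- The Maslovian condition in terms of the components
`C i j k = ⟨D²g (vᵢ, vⱼ), J dg (vₖ)⟩` of the cubic form in an orthonormal frame. -/
lemma maslovianAt_iff (h : LagrFrame g q Q v) {α : Fin 3 → ℝ} {H : V6}
    (hH : H = ∑ k, α k • Jc (fderiv ℝ g q (v k))) :
    MaslovianAt g q H ↔ (∃ k, α k ≠ 0) ∧ ∃ c : ℝ, ∀ k,
      ∑ i, ∑ j, α i * α j * ip6 (Q (v i) (v k)) (Jc (fderiv ℝ g q (v j))) = c * α k := by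
  have hne : H ≠ 0 ↔ ∃ k, α k ≠ 0 := by
    rw [← not_forall_not, not_iff_not]
    constructor
    · intro h0 k
      have := h.ip6_sum_normal α k
      rw [← hH, h0] at this
      simp [← this, ip6]
    · intro h0
      simp only [not_not] at h0
      simp [hH, h0]
  have hV : ∀ V, fderiv ℝ g q V = Jc H ↔ V = -∑ i, α i • v i := by
    have : Jc H = fderiv ℝ g q (-∑ i, α i • v i) := by
      rw [hH, ← JcLin_apply, map_sum, map_neg, map_sum, ← Finset.sum_neg_distrib]
      refine Finset.sum_congr rfl fun k _ => ?_
      rw [map_smul, JcLin_apply, Jc_Jc, map_smul, smul_neg]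
    intro V
    rw [this, h.inj.eq_iff]
  set S : Fin 3 → ℝ := fun k =>
    ∑ i, ∑ j, α i * α j * ip6 (Q (v i) (v k)) (Jc (fderiv ℝ g q (v j))) with hS
  have hip : ∀ w, ip6 (∑ k, ip6 (Q (-∑ i, α i • v i) w) (Jc (fderiv ℝ g q (v k))) •
      Jc (fderiv ℝ g q (v k))) H =
      -∑ i, ∑ j, α i * α j * ip6 (Q (v i) w) (Jc (fderiv ℝ g q (v j))) := by
    intro w
    rw [hH, ip6_comm, ip6_sum_left, Finset.sum_comm, eq_neg_iff_add_eq_zero,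
      ← Finset.sum_add_distrib]
    refine Finset.sum_eq_zero fun j _ => ?_
    rw [← eq_neg_iff_add_eq_zero]
    rw [ip6_smul_left, ip6_comm, h.ip6_sum_normal, map_neg, LinearMap.neg_apply, ip6_neg_left,
      map_sum, LinearMap.sum_apply, ip6_sum_left, mul_neg, Finset.mul_sum]
    congr 1
    refine Finset.sum_congr rfl fun i _ => ?_
    rw [map_smul, LinearMap.smul_apply, ip6_smul_left]
    ring
  have hu : ∀ u, IsShapeAt g q H (-∑ i, α i • v i) u ↔ u = -∑ k, S k • v k := by
    intro u
    have h1 : IsShapeAt g q H (-∑ i, α i • v i) u ↔ ∀ w,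
        ip6 (fderiv ℝ g q u) (fderiv ℝ g q w) =
          -∑ i, ∑ j, α i * α j * ip6 (Q (v i) w) (Jc (fderiv ℝ g q (v j))) := by
      refine forall_congr' fun w => ?_
      simp only [h.isSFF_iff, forall_eq, hip]
    rw [h1]
    constructor
    · intro hw
      rw [h.eq_sum u, ← Finset.sum_neg_distrib]
      exact Finset.sum_congr rfl fun k _ => by rw [hw, neg_smul]
    · rintro rfl w
      conv_lhs => rw [h.eq_sum w]
      conv_rhs => rw [h.eq_sum w]
      set c : Fin 3 → ℝ := fun k => ip6 (fderiv ℝ g q w) (fderiv ℝ g q (v k))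
      rw [map_neg, map_sum, map_sum]
      simp only [map_smul]
      rw [ip6_neg_left, ip6_sum_left]
      simp only [ip6_smul_left, ip6_comm (fderiv ℝ g q (v _)), h.ip6_sum_tangent]
      congr 1
      simp only [map_sum, map_smul, ip6_sum_left, ip6_smul_left, hS, Finset.mul_sum,
        Finset.sum_mul]
      rw [Finset.sum_comm]
      refine Finset.sum_congr rfl fun i _ => ?_
      rw [Finset.sum_comm]
      exact Finset.sum_congr rfl fun j _ => Finset.sum_congr rfl fun k _ => by ring
  unfold MaslovianAt
  rw [hne]
  refine and_congr_right fun _ => ?_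
  simp only [hV]
  constructor
  · intro hc
    obtain ⟨c, hc⟩ := hc _ _ rfl ((hu _).2 rfl)
    refine ⟨c, fun k => ?_⟩
    have h2 : ∑ k, S k • v k = ∑ k, (c * α k) • v k := by
      rw [smul_neg, neg_inj, Finset.smul_sum] at hc
      simpa [smul_smul] using hc
    have h3 := congrArg (fderiv ℝ g q) h2
    simp only [map_sum, map_smul] at h3
    rw [← h.ip6_sum_tangent (fun k => c * α k) k, ← h3, h.ip6_sum_tangent]
  · rintro ⟨c, hc⟩ V u rfl hs
    refine ⟨c, ?_⟩
    rw [(hu _).1 hs, smul_neg, Finset.smul_sum]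
    congr 1
    exact Finset.sum_congr rfl fun k _ => by rw [smul_smul, ← hc k]

lemma lagrangianAt (h : LagrFrame g q Q v) : LagrangianAt g q := by
  refine ⟨h.inj, Set.Subset.antisymm ?_ fun u hu => ?_⟩
  · rintro _ ⟨_, ⟨a, rfl⟩, rfl⟩ _ ⟨b, rfl⟩
    rw [ip6_comm, h.lagr]
  · refine ⟨_, ⟨∑ i, ip6 u (Jc (fderiv ℝ g q (v i))) • v i, rfl⟩, ?_⟩
    rw [← JcLin_apply, map_sum, map_sum]
    simp only [map_smul, JcLin_apply]
    refine h.ext_ip6 (fun i => ?_) (fun i => ?_)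
    · rw [h.ip6_sum_normal_tangent, hu _ ⟨v i, rfl⟩]
    · rw [h.ip6_sum_normal]

/-- The Maslovian condition in terms of the components of the cubic form in an orthogonal frame
`e` which becomes orthonormal after rescaling by `r`. -/
lemma forall_maslovianAt_iff {e : Fin 3 → W3} {r : Fin 3 → ℝ}
    (h : LagrFrame g q Q fun i => r i • e i) (hr : ∀ i, r i ≠ 0) {c : Fin 3 → Fin 3 → Fin 3 → ℝ}
    (hc : ∀ i j k, ip6 (Q (e i) (e j)) (Jc (fderiv ℝ g q (e k))) = c i j k) {a : Fin 3 → ℝ}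
    (ha : ∀ k, a k = ∑ i, r i ^ 2 * c i i k) :
    (∀ H, IsMeanCurvAt g q H → MaslovianAt g q H) ↔ (∃ k, a k ≠ 0) ∧ ∃ l : ℝ, ∀ k,
      ∑ i, ∑ j, r i ^ 2 * r j ^ 2 * a i * a j * c i k j = l * a k := by
  have hC : ∀ i j k, ip6 (Q (r i • e i) (r j • e j)) (Jc (fderiv ℝ g q (r k • e k))) =
      r i * r j * r k * c i j k := by
    intro i j k
    rw [← hc, map_smul, map_smul, map_smul, LinearMap.smul_apply, ← JcLin_apply, map_smul,
      ip6_smul_left, ip6_smul_left, ip6_comm, ip6_smul_left, ip6_comm, JcLin_apply]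
    ring
  have hα : ∀ k, ∑ i, ip6 (Q (r i • e i) (r i • e i)) (Jc (fderiv ℝ g q (r k • e k))) =
      r k * a k := by
    intro k
    rw [ha, Finset.mul_sum]
    exact Finset.sum_congr rfl fun i _ => by rw [hC]; ring
  simp only [h.isMeanCurvAt_iff, forall_eq]
  rw [h.maslovianAt_iff rfl]
  simp only [hα]
  simp only [hC, mul_ne_zero_iff, hr, ne_eq, not_false_eq_true, true_and]
  refine and_congr_right fun _ => exists_congr fun l => forall_congr' fun k => ?_
  have h1 : ∑ i, ∑ j, r i * a i * (r j * a j) * (r i * r k * r j * c i k j) =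
      r k * ∑ i, ∑ j, r i ^ 2 * r j ^ 2 * a i * a j * c i k j := by
    simp only [Finset.mul_sum]
    exact Finset.sum_congr rfl fun i _ => Finset.sum_congr rfl fun j _ => by ring
  rw [h1, mul_left_comm, mul_right_inj' (hr k)]

end LagrFrame

end LagrangianFrames

section SurfaceCalculus

/-- The second derivative of `F` at `p` in directions `u`, `v`. -/
def secondDeriv {E F : Type*} [NormedAddCommGroup E] [NormedSpace ℝ E] [NormedAddCommGroup F]
    [NormedSpace ℝ F] (f : E → F) (p u v : E) : F :=
  fderiv ℝ (fun y => fderiv ℝ f y v) p u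

section

variable {E F : Type*} [NormedAddCommGroup E] [NormedSpace ℝ E] [NormedAddCommGroup F]
  [NormedSpace ℝ F] {f : E → F} {p : E}

lemma ContDiffAt.fderiv_apply_const (hf : ContDiffAt ℝ (⊤ : ℕ∞) f p) (v : E) :
    ContDiffAt ℝ (⊤ : ℕ∞) (fun y => fderiv ℝ f y v) p :=
  (hf.fderiv_right (m := ((⊤ : ℕ∞) : WithTop ℕ∞)) (by rfl)).clm_apply contDiffAt_const

lemma ContDiffAt.secondDeriv_eq (hf : ContDiffAt ℝ (⊤ : ℕ∞) f p) (u v : E) :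
    secondDeriv f p u v = fderiv ℝ (fderiv ℝ f) p u v := by
  have h : DifferentiableAt ℝ (fderiv ℝ f) p :=
    (hf.fderiv_right (m := ((⊤ : ℕ∞) : WithTop ℕ∞)) (by rfl)).differentiableAt (by simp)
  rw [secondDeriv, fderiv_clm_apply h (differentiableAt_const v)]
  simp

lemma ContDiffAt.secondDeriv_comm (hf : ContDiffAt ℝ (⊤ : ℕ∞) f p) (u v : E) :
    secondDeriv f p u v = secondDeriv f p v u := by
  rw [hf.secondDeriv_eq, hf.secondDeriv_eq]
  exact hf.isSymmSndFDerivAt (by simp [minSmoothness_of_isRCLikeNormedField]; exact WithTop.coe_le_coe.2 le_top) u v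

end

namespace SurfaceData

variable {U : Set (ℝ × ℝ)} {x N : ℝ × ℝ → E3} {p : ℝ × ℝ}

lemma contDiffAt_x (hS : SurfaceData U x N) (hp : p ∈ U) : ContDiffAt ℝ (⊤ : ℕ∞) x p :=
  hS.smooth_x.contDiffAt (hS.open_U.mem_nhds hp)

lemma contDiffAt_N (hS : SurfaceData U x N) (hp : p ∈ U) : ContDiffAt ℝ (⊤ : ℕ∞) N p :=
  hS.smooth_N.contDiffAt (hS.open_U.mem_nhds hp)

lemma differentiableAt_x (hS : SurfaceData U x N) (hp : p ∈ U) : DifferentiableAt ℝ x p :=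
  (hS.contDiffAt_x hp).differentiableAt (by simp)

lemma differentiableAt_N (hS : SurfaceData U x N) (hp : p ∈ U) : DifferentiableAt ℝ N p :=
  (hS.contDiffAt_N hp).differentiableAt (by simp)

lemma differentiableAt_dx (hS : SurfaceData U x N) (hp : p ∈ U) (v : ℝ × ℝ) :
    DifferentiableAt ℝ (fun y => fderiv ℝ x y v) p :=
  ((hS.contDiffAt_x hp).fderiv_apply_const v).differentiableAt (by simp)

lemma differentiableAt_dN (hS : SurfaceData U x N) (hp : p ∈ U) (v : ℝ × ℝ) :
    DifferentiableAt ℝ (fun y => fderiv ℝ N y v) p :=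
  ((hS.contDiffAt_N hp).fderiv_apply_const v).differentiableAt (by simp)

/-- Functions agreeing on the open set `U` have the same derivative at points of `U`. -/
lemma fderiv_congr {F : Type*} [NormedAddCommGroup F] [NormedSpace ℝ F] {f g : ℝ × ℝ → F}
    (hS : SurfaceData U x N) (h : ∀ p ∈ U, f p = g p) (hp : p ∈ U) :
    fderiv ℝ f p = fderiv ℝ g p :=
  Filter.EventuallyEq.fderiv_eq (Filter.eventually_of_mem (hS.open_U.mem_nhds hp) h)

lemma inner_N_self (hS : SurfaceData U x N) (hp : p ∈ U) : ⟪N p, N p⟫_ℝ = 1 := by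
  rw [real_inner_self_eq_norm_sq, hS.unit_N p hp, one_pow]

lemma inner_N_dN (hS : SurfaceData U x N) (hp : p ∈ U) (v : ℝ × ℝ) :
    ⟪N p, fderiv ℝ N p v⟫_ℝ = 0 := by
  have h := congrArg (fun L => L v)
    (hS.fderiv_congr (g := fun _ => (1 : ℝ)) (fun p hp => hS.inner_N_self hp) hp)
  simp only [fderiv_inner_apply ℝ (hS.differentiableAt_N hp) (hS.differentiableAt_N hp)] at h
  rw [real_inner_comm] at h
  simp only [fderiv_fun_const, Pi.zero_apply, zero_apply] at h
  rw [real_inner_comm]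
  linarith [real_inner_comm (N p) (fderiv ℝ N p v)]

lemma inner_N_secondDeriv_x (hS : SurfaceData U x N) (hp : p ∈ U) (u v : ℝ × ℝ) :
    ⟪N p, secondDeriv x p u v⟫_ℝ = -⟪fderiv ℝ N p u, fderiv ℝ x p v⟫_ℝ := by
  have h := congrArg (fun L => L u)
    (hS.fderiv_congr (g := fun _ => (0 : ℝ)) (fun p hp => hS.normal_N p hp v) hp)
  simp only [fderiv_inner_apply ℝ (hS.differentiableAt_N hp) (hS.differentiableAt_dx hp v)] at h
  simp only [fderiv_fun_const, Pi.zero_apply, zero_apply] at h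
  rw [secondDeriv]
  linarith

/-- The shape operator is self-adjoint. -/
lemma inner_dN_dx_comm (hS : SurfaceData U x N) (hp : p ∈ U) (u v : ℝ × ℝ) :
    ⟪fderiv ℝ N p u, fderiv ℝ x p v⟫_ℝ = ⟪fderiv ℝ N p v, fderiv ℝ x p u⟫_ℝ := by
  have h1 := hS.inner_N_secondDeriv_x hp u v
  have h2 := hS.inner_N_secondDeriv_x hp v u
  rw [(hS.contDiffAt_x hp).secondDeriv_comm] at h1
  linarith

end SurfaceData

/-- Up to sign, the covariant derivative of the second fundamental form of the surface. -/
def codazziForm (x N : ℝ × ℝ → E3) (p u v w : ℝ × ℝ) : ℝ :=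
  ⟪secondDeriv N p u v, fderiv ℝ x p w⟫_ℝ - ⟪secondDeriv x p u v, fderiv ℝ N p w⟫_ℝ

namespace SurfaceData

variable {U : Set (ℝ × ℝ)} {x N : ℝ × ℝ → E3} {p : ℝ × ℝ}

lemma codazziForm_comm_left (hS : SurfaceData U x N) (hp : p ∈ U) (u v w : ℝ × ℝ) :
    codazziForm x N p u v w = codazziForm x N p v u w := by
  rw [codazziForm, codazziForm, (hS.contDiffAt_x hp).secondDeriv_comm,
    (hS.contDiffAt_N hp).secondDeriv_comm]

lemma codazziForm_comm_right (hS : SurfaceData U x N) (hp : p ∈ U) (u v w : ℝ × ℝ) :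
    codazziForm x N p u v w = codazziForm x N p u w v := by
  have h := congrArg (fun L => L u)
    (hS.fderiv_congr (fun p hp => hS.inner_dN_dx_comm hp v w) hp)
  simp only [fderiv_inner_apply ℝ (hS.differentiableAt_dN hp _) (hS.differentiableAt_dx hp _)] at h
  simp only [codazziForm, secondDeriv]
  rw [real_inner_comm (fderiv ℝ N p w), real_inner_comm (fderiv ℝ N p v)]
  linarith

lemma fderiv_nbi (hS : SurfaceData U x N) {q : W3} (hq : q.1 ∈ U) (w : W3) :
    fderiv ℝ (nbi x N) q w =
      (fderiv ℝ x q.1 w.1, w.2 • N q.1 + q.2 • fderiv ℝ N q.1 w.1) := by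
  have h1 : HasFDerivAt (fun q : W3 => x q.1) _ q :=
    (hS.differentiableAt_x hq).hasFDerivAt.comp q hasFDerivAt_fst
  have h2 : HasFDerivAt (fun q : W3 => N q.1) _ q :=
    (hS.differentiableAt_N hq).hasFDerivAt.comp q hasFDerivAt_fst
  have h3 : HasFDerivAt (nbi x N) _ q := h1.prodMk (hasFDerivAt_snd.smul h2)
  rw [h3.fderiv]
  simp [add_comm]

lemma d2_nbi (hS : SurfaceData U x N) {q : W3} (hq : q.1 ∈ U) (v w : W3) :
    d2 (nbi x N) q v w = (secondDeriv x q.1 v.1 w.1,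
      w.2 • fderiv ℝ N q.1 v.1 + v.2 • fderiv ℝ N q.1 w.1 +
        q.2 • secondDeriv N q.1 v.1 w.1) := by
  have h0 : (fun y => fderiv ℝ (nbi x N) y w) =ᶠ[nhds q] fun y =>
      (fderiv ℝ x y.1 w.1, w.2 • N y.1 + y.2 • fderiv ℝ N y.1 w.1) := by
    filter_upwards [continuous_fst.continuousAt.preimage_mem_nhds (hS.open_U.mem_nhds hq)]
      with y hy using hS.fderiv_nbi hy w
  have h1 : HasFDerivAt (fun q : W3 => fderiv ℝ x q.1 w.1) _ q :=
    (hS.differentiableAt_dx hq w.1).hasFDerivAt.comp q hasFDerivAt_fst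
  have h2 : HasFDerivAt (fun q : W3 => N q.1) _ q :=
    (hS.differentiableAt_N hq).hasFDerivAt.comp q hasFDerivAt_fst
  have h3 : HasFDerivAt (fun q : W3 => fderiv ℝ N q.1 w.1) _ q :=
    (hS.differentiableAt_dN hq w.1).hasFDerivAt.comp q hasFDerivAt_fst
  have h4 := h1.prodMk ((h2.const_smul w.2).add (hasFDerivAt_snd.smul h3))
  rw [d2, h0.fderiv_eq]
  refine (congrArg (fun L => L v) h4.fderiv).trans ?_
  simp [secondDeriv, add_comm, add_left_comm, add_assoc]

/-- The second derivative of the normal bundle immersion as a bilinear map. -/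
lemma exists_bilin_d2 (hS : SurfaceData U x N) {q : W3} (hq : q.1 ∈ U) :
    ∃ Q : W3 →ₗ[ℝ] W3 →ₗ[ℝ] V6, ∀ v w, d2 (nbi x N) q v w = Q v w := by
  have hf : ContDiffAt ℝ (⊤ : ℕ∞) (nbi x N) q :=
    ((hS.contDiffAt_x hq).comp q contDiffAt_fst).prodMk
      (contDiffAt_snd.smul ((hS.contDiffAt_N hq).comp q contDiffAt_fst))
  exact ⟨(ContinuousLinearMap.coeLM ℝ).comp
    (fderiv ℝ (fderiv ℝ (nbi x N)) q : W3 →ₗ[ℝ] W3 →L[ℝ] V6),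
    fun v w => hf.secondDeriv_eq v w⟩

end SurfaceData

/-- `ξ₁, ξ₂` is an orthonormal frame of principal directions at `p`, with principal curvatures
`κ₁, κ₂`. -/
structure PrincipalFrame (x N : ℝ × ℝ → E3) (p ξ₁ ξ₂ : ℝ × ℝ) (κ₁ κ₂ : ℝ) : Prop where
  norm₁ : ⟪fderiv ℝ x p ξ₁, fderiv ℝ x p ξ₁⟫_ℝ = 1
  norm₂ : ⟪fderiv ℝ x p ξ₂, fderiv ℝ x p ξ₂⟫_ℝ = 1
  orth : ⟪fderiv ℝ x p ξ₁, fderiv ℝ x p ξ₂⟫_ℝ = 0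
  eig₁ : fderiv ℝ N p ξ₁ = -κ₁ • fderiv ℝ x p ξ₁
  eig₂ : fderiv ℝ N p ξ₂ = -κ₂ • fderiv ℝ x p ξ₂

namespace PrincipalFrame

variable {x N : ℝ × ℝ → E3} {p ξ₁ ξ₂ : ℝ × ℝ} {κ₁ κ₂ : ℝ}

lemma norm_eq_one₁ (h : PrincipalFrame x N p ξ₁ ξ₂ κ₁ κ₂) : ‖fderiv ℝ x p ξ₁‖ = 1 := by
  rw [norm_eq_sqrt_real_inner, h.norm₁, Real.sqrt_one]

lemma norm_eq_one₂ (h : PrincipalFrame x N p ξ₁ ξ₂ κ₁ κ₂) : ‖fderiv ℝ x p ξ₂‖ = 1 := by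
  rw [norm_eq_sqrt_real_inner, h.norm₂, Real.sqrt_one]

end PrincipalFrame

namespace SurfaceData

variable {U : Set (ℝ × ℝ)} {x N : ℝ × ℝ → E3} {p : ℝ × ℝ}

lemma exists_lagrFrame (hS : SurfaceData U x N) (hp : p ∈ U) {ξ₁ ξ₂ : ℝ × ℝ} {κ₁ κ₂ : ℝ}
    (h : PrincipalFrame x N p ξ₁ ξ₂ κ₁ κ₂) (t : ℝ) :
    ∃ Q : W3 →ₗ[ℝ] W3 →ₗ[ℝ] V6, LagrFrame (nbi x N) (p, t) Q fun i =>
      ![(√(1 + t ^ 2 * κ₁ ^ 2))⁻¹, (√(1 + t ^ 2 * κ₂ ^ 2))⁻¹, 1] i •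
        (![(ξ₁, 0), (ξ₂, 0), (0, 1)] : Fin 3 → W3) i := by
  obtain ⟨Q, hQ⟩ := hS.exists_bilin_d2 (q := (p, t)) hp
  have hx := hS.normal_N p hp
  have hx' : ∀ v, ⟪fderiv ℝ x p v, N p⟫_ℝ = 0 := fun v => by rw [real_inner_comm, hx]
  have hn := hS.inner_N_dN hp
  have hn' : ∀ v, ⟪fderiv ℝ N p v, N p⟫_ℝ = 0 := fun v => by rw [real_inner_comm, hn]
  have horth' := h.orth
  rw [real_inner_comm] at horth'
  have hf := hS.fderiv_nbi (q := (p, t)) hp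
  refine ⟨Q, hQ, ?_, ?_, ?_⟩
  · rw [injective_iff_map_eq_zero]
    intro a ha
    rw [hS.fderiv_nbi hp, Prod.mk_eq_zero] at ha
    have h1 : a.1 = 0 := (injective_iff_map_eq_zero _).1 (hS.immersion p hp) _ ha.1
    have h2 : a.2 = 0 := by
      have h2 := congrArg (fun z => ⟪N p, z⟫_ℝ) ha.2
      rw [h1, map_zero, smul_zero, add_zero, real_inner_smul_right, hS.inner_N_self hp,
        inner_zero_right, mul_one] at h2
      exact h2
    exact Prod.ext h1 h2
  · have hpos : ∀ κ : ℝ, 0 < 1 + t ^ 2 * κ ^ 2 := fun κ => by positivity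
    have hr : ∀ κ : ℝ, (√(1 + t ^ 2 * κ ^ 2))⁻¹ * ((√(1 + t ^ 2 * κ ^ 2))⁻¹ *
        (1 + t ^ 2 * κ ^ 2)) = 1 := by
      intro κ
      have h1 := Real.sq_sqrt (hpos κ).le
      have h2 := Real.sqrt_pos.2 (hpos κ)
      field_simp
      linarith
    intro i j
    simp only [map_smul]
    rw [ip6_smul_left, ip6_comm, ip6_smul_left, ip6_comm]
    fin_cases i <;> fin_cases j <;>
      simp [hf, ip6, h.norm_eq_one₁, h.norm_eq_one₂, h.orth, horth', h.eig₁, h.eig₂, hx, hx',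
        inner_smul_left, inner_smul_right, norm_smul, mul_pow, hS.unit_N p hp, hr]
  · intro a b
    simp only [hf, ip6, Jc, inner_add_left, inner_neg_right, inner_add_right,
      inner_smul_left, inner_smul_right, hx, hx', hS.inner_dN_dx_comm hp a.1 b.1,
      real_inner_comm (fderiv ℝ N p b.1) (fderiv ℝ x p a.1)]
    simp

/-- The cubic form of the normal bundle immersion. -/
lemma ip6_d2_nbi (hS : SurfaceData U x N) {q : W3} (hq : q.1 ∈ U) (a b c : W3) :
    ip6 (d2 (nbi x N) q a b) (Jc (fderiv ℝ (nbi x N) q c)) =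
      q.2 * codazziForm x N q.1 a.1 b.1 c.1 + c.2 * ⟪fderiv ℝ N q.1 a.1, fderiv ℝ x q.1 b.1⟫_ℝ +
        b.2 * ⟪fderiv ℝ N q.1 a.1, fderiv ℝ x q.1 c.1⟫_ℝ +
        a.2 * ⟪fderiv ℝ N q.1 b.1, fderiv ℝ x q.1 c.1⟫_ℝ := by
  have h := hS.inner_N_secondDeriv_x hq a.1 b.1
  rw [real_inner_comm] at h
  simp only [hS.d2_nbi hq, hS.fderiv_nbi hq, ip6, Jc, inner_add_left, inner_neg_right,
    inner_add_right, real_inner_smul_left, real_inner_smul_right, h, codazziForm]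
  ring

/-- The Maslovian condition at `(p, t)` in terms of the principal curvatures `κᵢ` at `p` and the
components `Tᵢⱼₖ` of the Codazzi form, where `ρᵢ = (1 + t²κᵢ²)⁻¹`. -/
lemma forall_maslovianAt_nbi_iff (hS : SurfaceData U x N) (hp : p ∈ U) {ξ₁ ξ₂ : ℝ × ℝ}
    {κ₁ κ₂ : ℝ} (h : PrincipalFrame x N p ξ₁ ξ₂ κ₁ κ₂) (t : ℝ) {ρ₁ ρ₂ T₁ T₂ T₃ T₄ a₁ a₂ a₃ : ℝ}
    (hρ₁ : ρ₁ = (1 + t ^ 2 * κ₁ ^ 2)⁻¹) (hρ₂ : ρ₂ = (1 + t ^ 2 * κ₂ ^ 2)⁻¹)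
    (hT₁ : T₁ = codazziForm x N p ξ₁ ξ₁ ξ₁) (hT₂ : T₂ = codazziForm x N p ξ₁ ξ₁ ξ₂)
    (hT₃ : T₃ = codazziForm x N p ξ₁ ξ₂ ξ₂) (hT₄ : T₄ = codazziForm x N p ξ₂ ξ₂ ξ₂)
    (ha₁ : a₁ = t * (ρ₁ * T₁ + ρ₂ * T₃)) (ha₂ : a₂ = t * (ρ₁ * T₂ + ρ₂ * T₄))
    (ha₃ : a₃ = -(ρ₁ * κ₁ + ρ₂ * κ₂)) :
    (∀ H, IsMeanCurvAt (nbi x N) (p, t) H → MaslovianAt (nbi x N) (p, t) H) ↔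
      (a₁ ≠ 0 ∨ a₂ ≠ 0 ∨ a₃ ≠ 0) ∧ ∃ l : ℝ,
        t * (ρ₁ ^ 2 * a₁ ^ 2 * T₁ + 2 * ρ₁ * ρ₂ * a₁ * a₂ * T₂ + ρ₂ ^ 2 * a₂ ^ 2 * T₃) -
          2 * ρ₁ * a₁ * a₃ * κ₁ = l * a₁ ∧
        t * (ρ₁ ^ 2 * a₁ ^ 2 * T₂ + 2 * ρ₁ * ρ₂ * a₁ * a₂ * T₃ + ρ₂ ^ 2 * a₂ ^ 2 * T₄) -
          2 * ρ₂ * a₂ * a₃ * κ₂ = l * a₂ ∧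
        -(κ₁ * ρ₁ ^ 2 * a₁ ^ 2 + κ₂ * ρ₂ ^ 2 * a₂ ^ 2) = l * a₃ := by
  obtain ⟨Q, hQ⟩ := hS.exists_lagrFrame hp h t
  have hr : ∀ i, ![(√(1 + t ^ 2 * κ₁ ^ 2))⁻¹, (√(1 + t ^ 2 * κ₂ ^ 2))⁻¹, 1] i ≠ 0 := by
    intro i
    have h1 : 0 < 1 + t ^ 2 * κ₁ ^ 2 := by positivity
    have h2 : 0 < 1 + t ^ 2 * κ₂ ^ 2 := by positivity
    have h3 := (Real.sqrt_pos.2 h1).ne'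
    have h4 := (Real.sqrt_pos.2 h2).ne'
    fin_cases i <;> simp [h3, h4]
  have hr₁ : (√(1 + t ^ 2 * κ₁ ^ 2))⁻¹ ^ 2 = ρ₁ := by
    rw [inv_pow, Real.sq_sqrt (by positivity), hρ₁]
  have hr₂ : (√(1 + t ^ 2 * κ₂ ^ 2))⁻¹ ^ 2 = ρ₂ := by
    rw [inv_pow, Real.sq_sqrt (by positivity), hρ₂]
  have horth' := h.orth
  rw [real_inner_comm] at horth'
  have hc : ∀ i j k, ip6 (Q ((![(ξ₁, 0), (ξ₂, 0), (0, 1)] : Fin 3 → W3) i)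
      ((![(ξ₁, 0), (ξ₂, 0), (0, 1)] : Fin 3 → W3) j))
      (Jc (fderiv ℝ (nbi x N) (p, t) ((![(ξ₁, 0), (ξ₂, 0), (0, 1)] : Fin 3 → W3) k))) =
      ![![![t * T₁, t * T₂, -κ₁], ![t * T₂, t * T₃, 0], ![-κ₁, 0, 0]],
        ![![t * T₂, t * T₃, 0], ![t * T₃, t * T₄, -κ₂], ![0, -κ₂, 0]],
        ![![-κ₁, 0, 0], ![0, -κ₂, 0], ![0, 0, 0]]] i j k := by
    have e1 : codazziForm x N p ξ₁ ξ₂ ξ₁ = T₂ := by rw [hT₂, hS.codazziForm_comm_right hp]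
    have e2 : codazziForm x N p ξ₂ ξ₁ ξ₁ = T₂ := by rw [← e1, hS.codazziForm_comm_left hp]
    have e3 : codazziForm x N p ξ₂ ξ₁ ξ₂ = T₃ := by rw [hT₃, hS.codazziForm_comm_left hp]
    have e4 : codazziForm x N p ξ₂ ξ₂ ξ₁ = T₃ := by rw [← e3, hS.codazziForm_comm_right hp]
    have z : ∀ u v, codazziForm x N p u v 0 = 0 := fun u v => by simp [codazziForm]
    have z' : ∀ u v, codazziForm x N p u 0 v = 0 := fun u v => by
      rw [hS.codazziForm_comm_right hp, z]
    have z'' : ∀ u v, codazziForm x N p 0 u v = 0 := fun u v => by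
      rw [hS.codazziForm_comm_left hp, z']
    intro i j k
    rw [← hQ.d2_eq, hS.ip6_d2_nbi hp]
    fin_cases i <;> fin_cases j <;> fin_cases k <;>
      simp [h.eig₁, h.eig₂, h.orth, horth', real_inner_smul_left, e1, e2, e3, e4,
        z, z', z'', ← hT₁, ← hT₂, ← hT₃, ← hT₄, h.norm_eq_one₁, h.norm_eq_one₂]
  rw [hQ.forall_maslovianAt_iff hr hc (a := ![a₁, a₂, a₃])]
  · simp only [Fin.sum_univ_three, Fin.forall_fin_succ, Fin.exists_fin_succ]
    simp [hr₁, hr₂, -inv_pow]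
    refine fun _ => exists_congr fun l => ?_
    constructor <;> rintro ⟨h1, h2, h3⟩ <;> refine ⟨?_, ?_, ?_⟩ <;> linarith
  · intro k
    simp only [Fin.sum_univ_three]
    fin_cases k
    · simp [-inv_pow, hr₁, hr₂, ha₁]; ring
    · simp [-inv_pow, hr₁, hr₂, ha₂]; ring
    · simp [-inv_pow, hr₁, hr₂, ha₃]; ring

end SurfaceData

end SurfaceCalculus

section PrincipalFrames

/-- Orthonormality of a triple of vectors, spelled out. -/
lemma orthonormal_triple {E : Type*} [NormedAddCommGroup E] [InnerProductSpace ℝ E] {a b c : E}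
    (haa : ⟪a, a⟫_ℝ = 1) (hbb : ⟪b, b⟫_ℝ = 1) (hcc : ⟪c, c⟫_ℝ = 1) (hab : ⟪a, b⟫_ℝ = 0)
    (hac : ⟪a, c⟫_ℝ = 0) (hbc : ⟪b, c⟫_ℝ = 0) : Orthonormal ℝ ![a, b, c] := by
  rw [orthonormal_iff_ite]
  intro i j
  fin_cases i <;> fin_cases j <;>
    simp only [Fin.zero_eta, Fin.mk_one, Fin.reduceFinMk, Matrix.cons_val, if_true, haa, hbb, hcc,
      hab, hac, hbc, real_inner_comm a b, real_inner_comm a c, real_inner_comm b c] <;> simp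

/-- Expansion of a vector of `E3` in an orthonormal triple. -/
lemma Orthonormal.eq_sum_triple {a b c : E3} (h : Orthonormal ℝ ![a, b, c]) (z : E3) :
    z = ⟪a, z⟫_ℝ • a + ⟪b, z⟫_ℝ • b + ⟪c, z⟫_ℝ • c := by
  have hs : ⊤ ≤ Submodule.span ℝ (Set.range ![a, b, c]) := by
    rw [h.linearIndependent.span_eq_top_of_card_eq_finrank (by simp)]
  have h1 := (OrthonormalBasis.mk h hs).sum_repr' z
  simpa [Fin.sum_univ_three] using h1.symm

namespace SurfaceData

variable {U : Set (ℝ × ℝ)} {x N : ℝ × ℝ → E3} {p : ℝ × ℝ}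

/-- The differential of `x` as an isomorphism onto the orthogonal complement of the normal. -/
lemma exists_linearEquiv (hS : SurfaceData U x N) (hp : p ∈ U) :
    ∃ e : (ℝ × ℝ) ≃ₗ[ℝ] (ℝ ∙ N p)ᗮ, ∀ v, (e v : E3) = fderiv ℝ x p v := by
  have hmem : ∀ v, (fderiv ℝ x p : ℝ × ℝ →ₗ[ℝ] E3) v ∈ (ℝ ∙ N p)ᗮ := fun v =>
    (Submodule.mem_orthogonal_singleton_iff_inner_right).2 (hS.normal_N p hp v)
  have hN : N p ≠ 0 := fun h0 => by simpa [h0] using hS.unit_N p hp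
  have : Fact (Module.finrank ℝ E3 = 2 + 1) := ⟨by simp⟩
  have hd : Module.finrank ℝ (ℝ × ℝ) = Module.finrank ℝ (ℝ ∙ N p)ᗮ := by
    rw [Submodule.finrank_orthogonal_span_singleton (n := 2) hN]; simp
  exact ⟨LinearEquiv.ofInjectiveOfFinrankEq (LinearMap.codRestrict _ _ hmem)
    (fun a b hab => hS.immersion p hp (congrArg Subtype.val hab)) hd, fun v => rfl⟩

lemma exists_fderiv_eq (hS : SurfaceData U x N) (hp : p ∈ U) {z : E3} (hz : ⟪N p, z⟫_ℝ = 0) :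
    ∃ v, fderiv ℝ x p v = z := by
  obtain ⟨e, he⟩ := hS.exists_linearEquiv hp
  refine ⟨e.symm ⟨z, (Submodule.mem_orthogonal_singleton_iff_inner_right).2 hz⟩, ?_⟩
  rw [← he, e.apply_symm_apply]

/-- Principal frames exist at every point. -/
lemma exists_principalFrame (hS : SurfaceData U x N) (hp : p ∈ U) :
    ∃ ξ₁ ξ₂ κ₁ κ₂, PrincipalFrame x N p ξ₁ ξ₂ κ₁ κ₂ := by
  obtain ⟨e, he⟩ := hS.exists_linearEquiv hp
  have hmem : ∀ v, (fderiv ℝ N p : ℝ × ℝ →ₗ[ℝ] E3) v ∈ (ℝ ∙ N p)ᗮ := fun v =>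
    (Submodule.mem_orthogonal_singleton_iff_inner_right).2 (hS.inner_N_dN hp v)
  set T : (ℝ ∙ N p)ᗮ →ₗ[ℝ] (ℝ ∙ N p)ᗮ :=
    (LinearMap.codRestrict _ _ hmem).comp e.symm.toLinearMap with hT
  have hTe : ∀ v, (T (e v) : E3) = fderiv ℝ N p v := fun v => by simp [hT]
  have hsymm : T.IsSymmetric := by
    intro a b
    obtain ⟨v, rfl⟩ := e.surjective a
    obtain ⟨w, rfl⟩ := e.surjective b
    rw [Submodule.coe_inner, Submodule.coe_inner, hTe, hTe, he, he, hS.inner_dN_dx_comm hp,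
      real_inner_comm]
  have hN : N p ≠ 0 := fun h0 => by simpa [h0] using hS.unit_N p hp
  have : Fact (Module.finrank ℝ E3 = 2 + 1) := ⟨by simp⟩
  have hd : Module.finrank ℝ (ℝ ∙ N p)ᗮ = 2 := Submodule.finrank_orthogonal_span_singleton hN
  set b := hsymm.eigenvectorBasis hd
  have hb : ∀ i, fderiv ℝ x p (e.symm (b i)) = b i := fun i => by rw [← he, e.apply_symm_apply]
  have horth := fun i j => orthonormal_iff_ite.1 b.orthonormal i j
  simp only [Submodule.coe_inner] at horth
  have heig : ∀ i, fderiv ℝ N p (e.symm (b i)) = hsymm.eigenvalues hd i • (b i : E3) := fun i => by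
    rw [← hTe, e.apply_symm_apply]
    exact congrArg Subtype.val (hsymm.apply_eigenvectorBasis hd i)
  refine ⟨e.symm (b 0), e.symm (b 1), -hsymm.eigenvalues hd 0, -hsymm.eigenvalues hd 1, ?_, ?_, ?_,
    ?_, ?_⟩
  · rw [hb, horth, if_pos rfl]
  · rw [hb, horth, if_pos rfl]
  · rw [hb, hb, horth, if_neg (by decide)]
  · rw [heig, hb, neg_neg]
  · rw [heig, hb, neg_neg]

end SurfaceData

namespace PrincipalFrame

variable {U : Set (ℝ × ℝ)} {x N : ℝ × ℝ → E3} {p ξ₁ ξ₂ : ℝ × ℝ} {κ₁ κ₂ : ℝ}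

lemma orthonormal (h : PrincipalFrame x N p ξ₁ ξ₂ κ₁ κ₂) (hS : SurfaceData U x N) (hp : p ∈ U) :
    Orthonormal ℝ ![fderiv ℝ x p ξ₁, fderiv ℝ x p ξ₂, N p] :=
  orthonormal_triple h.norm₁ h.norm₂ (hS.inner_N_self hp) h.orth
    (by rw [real_inner_comm, hS.normal_N p hp]) (by rw [real_inner_comm, hS.normal_N p hp])

lemma eq_add (h : PrincipalFrame x N p ξ₁ ξ₂ κ₁ κ₂) (hS : SurfaceData U x N) (hp : p ∈ U)
    (v : ℝ × ℝ) : v = ⟪fderiv ℝ x p ξ₁, fderiv ℝ x p v⟫_ℝ • ξ₁ +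
      ⟪fderiv ℝ x p ξ₂, fderiv ℝ x p v⟫_ℝ • ξ₂ := by
  apply hS.immersion p hp
  have h1 := (h.orthonormal hS hp).eq_sum_triple (fderiv ℝ x p v)
  rw [hS.normal_N p hp, zero_smul, add_zero] at h1
  rw [map_add, map_smul, map_smul]
  exact h1

/-- A linear map on the parameter plane vanishing on a principal frame is zero. -/
lemma clm_ext {F : Type*} [NormedAddCommGroup F] [NormedSpace ℝ F]
    (h : PrincipalFrame x N p ξ₁ ξ₂ κ₁ κ₂) (hS : SurfaceData U x N) (hp : p ∈ U)
    {A B : ℝ × ℝ →L[ℝ] F} (h1 : A ξ₁ = B ξ₁) (h2 : A ξ₂ = B ξ₂) : A = B := by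
  ext1 <;> ext <;> simp
  · rw [h.eq_add hS hp (1, 0)]; simp only [map_add, map_smul, h1, h2]
  · rw [h.eq_add hS hp (0, 1)]; simp only [map_add, map_smul, h1, h2]

end PrincipalFrame

/-- The first fundamental form. -/
def firstForm (x : ℝ × ℝ → E3) (u v p : ℝ × ℝ) : ℝ := ⟪fderiv ℝ x p u, fderiv ℝ x p v⟫_ℝ

/-- The second fundamental form. -/
def secondForm (x N : ℝ × ℝ → E3) (u v p : ℝ × ℝ) : ℝ := -⟪fderiv ℝ N p u, fderiv ℝ x p v⟫_ℝ

/-- The Gram determinant of `u`, `v` for the first fundamental form. -/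
def gramDet (x : ℝ × ℝ → E3) (u v p : ℝ × ℝ) : ℝ :=
  firstForm x u u p * firstForm x v v p - firstForm x u v p ^ 2

/-- The trace of the shape operator. -/
def curvTrace (x N : ℝ × ℝ → E3) (p : ℝ × ℝ) : ℝ :=
  (secondForm x N (1, 0) (1, 0) p * firstForm x (0, 1) (0, 1) p -
      2 * (secondForm x N (1, 0) (0, 1) p * firstForm x (1, 0) (0, 1) p) +
      secondForm x N (0, 1) (0, 1) p * firstForm x (1, 0) (1, 0) p) / gramDet x (1, 0) (0, 1) p

/-- The Gauss curvature. -/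
def gaussCurv (x N : ℝ × ℝ → E3) (p : ℝ × ℝ) : ℝ :=
  (secondForm x N (1, 0) (1, 0) p * secondForm x N (0, 1) (0, 1) p -
      secondForm x N (1, 0) (0, 1) p ^ 2) / gramDet x (1, 0) (0, 1) p

namespace PrincipalFrame

variable {U : Set (ℝ × ℝ)} {x N : ℝ × ℝ → E3} {p ξ₁ ξ₂ : ℝ × ℝ} {κ₁ κ₂ : ℝ}

lemma firstForm_eq (h : PrincipalFrame x N p ξ₁ ξ₂ κ₁ κ₂) (a b c d : ℝ) :
    firstForm x (a • ξ₁ + b • ξ₂) (c • ξ₁ + d • ξ₂) p = a * c + b * d := by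
  have horth := h.orth
  rw [real_inner_comm] at horth
  simp only [firstForm, map_add, map_smul, inner_add_left, inner_add_right, real_inner_smul_left,
    real_inner_smul_right, h.norm₁, h.norm₂, h.orth, horth]
  ring

lemma secondForm_eq (h : PrincipalFrame x N p ξ₁ ξ₂ κ₁ κ₂) (a b c d : ℝ) :
    secondForm x N (a • ξ₁ + b • ξ₂) (c • ξ₁ + d • ξ₂) p = κ₁ * a * c + κ₂ * b * d := by
  have horth := h.orth
  rw [real_inner_comm] at horth
  simp only [secondForm, map_add, map_smul, inner_add_left, inner_add_right, real_inner_smul_left,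
    real_inner_smul_right, h.norm₁, h.norm₂, h.orth, horth, h.eig₁, h.eig₂]
  ring

lemma trace_mul_gramDet (h : PrincipalFrame x N p ξ₁ ξ₂ κ₁ κ₂) (hS : SurfaceData U x N)
    (hp : p ∈ U) (u v : ℝ × ℝ) :
    secondForm x N u u p * firstForm x v v p - 2 * (secondForm x N u v p * firstForm x u v p) +
      secondForm x N v v p * firstForm x u u p = (κ₁ + κ₂) * gramDet x u v p := by
  rw [gramDet, h.eq_add hS hp u, h.eq_add hS hp v]
  simp only [h.firstForm_eq, h.secondForm_eq]
  ring

lemma det_mul_gramDet (h : PrincipalFrame x N p ξ₁ ξ₂ κ₁ κ₂) (hS : SurfaceData U x N)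
    (hp : p ∈ U) (u v : ℝ × ℝ) :
    secondForm x N u u p * secondForm x N v v p - secondForm x N u v p ^ 2 =
      κ₁ * κ₂ * gramDet x u v p := by
  rw [gramDet, h.eq_add hS hp u, h.eq_add hS hp v]
  simp only [h.firstForm_eq, h.secondForm_eq]
  ring

end PrincipalFrame

namespace SurfaceData

variable {U : Set (ℝ × ℝ)} {x N : ℝ × ℝ → E3} {p : ℝ × ℝ}

lemma gramDet_ne_zero (hS : SurfaceData U x N) (hp : p ∈ U) :
    gramDet x (1, 0) (0, 1) p ≠ 0 := by
  intro h0
  set a := fderiv ℝ x p (1, 0)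
  set b := fderiv ℝ x p (0, 1)
  have h1 : ⟪a, a⟫_ℝ * ⟪b, b⟫_ℝ - ⟪a, b⟫_ℝ ^ 2 = 0 := h0
  have hb : fderiv ℝ x p (-⟪a, b⟫_ℝ, ⟪a, a⟫_ℝ) = ⟪a, a⟫_ℝ • b - ⟪a, b⟫_ℝ • a := by
    rw [show (-⟪a, b⟫_ℝ, ⟪a, a⟫_ℝ) = ⟪a, a⟫_ℝ • ((0, 1) : ℝ × ℝ) - ⟪a, b⟫_ℝ • ((1, 0) : ℝ × ℝ) by
      simp, map_sub, map_smul, map_smul]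
  have h2 : ⟪a, a⟫_ℝ • b - ⟪a, b⟫_ℝ • a = 0 := by
    rw [← inner_self_eq_zero (𝕜 := ℝ)]
    simp only [inner_sub_left, inner_sub_right, real_inner_smul_left, real_inner_smul_right,
      real_inner_comm a b]
    linear_combination ⟪a, a⟫_ℝ * h1
  have h3 := (injective_iff_map_eq_zero _).1 (hS.immersion p hp) _ (hb.trans h2)
  have h4 : a = 0 := inner_self_eq_zero.1 (congrArg Prod.snd h3)
  have h5 := (injective_iff_map_eq_zero _).1 (hS.immersion p hp) _ h4
  simp at h5

lemma contDiffAt_firstForm (hS : SurfaceData U x N) (hp : p ∈ U) (u v : ℝ × ℝ) :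
    ContDiffAt ℝ (⊤ : ℕ∞) (firstForm x u v) p :=
  ((hS.contDiffAt_x hp).fderiv_apply_const u).inner ℝ ((hS.contDiffAt_x hp).fderiv_apply_const v)

lemma contDiffAt_secondForm (hS : SurfaceData U x N) (hp : p ∈ U) (u v : ℝ × ℝ) :
    ContDiffAt ℝ (⊤ : ℕ∞) (secondForm x N u v) p :=
  (((hS.contDiffAt_N hp).fderiv_apply_const u).inner ℝ
    ((hS.contDiffAt_x hp).fderiv_apply_const v)).neg

lemma contDiffAt_curvTrace (hS : SurfaceData U x N) (hp : p ∈ U) :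
    ContDiffAt ℝ (⊤ : ℕ∞) (curvTrace x N) p := by
  have hE := hS.contDiffAt_firstForm hp
  have hL := hS.contDiffAt_secondForm hp
  exact ((((hL _ _).mul (hE _ _)).sub (contDiffAt_const.mul ((hL _ _).mul (hE _ _)))).add
    ((hL _ _).mul (hE _ _))).div (((hE _ _).mul (hE _ _)).sub ((hE _ _).pow 2))
    (hS.gramDet_ne_zero hp)

lemma contDiffAt_gaussCurv (hS : SurfaceData U x N) (hp : p ∈ U) :
    ContDiffAt ℝ (⊤ : ℕ∞) (gaussCurv x N) p := by
  have hE := hS.contDiffAt_firstForm hp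
  have hL := hS.contDiffAt_secondForm hp
  exact (((hL _ _).mul (hL _ _)).sub ((hL _ _).pow 2)).div
    (((hE _ _).mul (hE _ _)).sub ((hE _ _).pow 2)) (hS.gramDet_ne_zero hp)

lemma differentiableAt_curvTrace (hS : SurfaceData U x N) (hp : p ∈ U) :
    DifferentiableAt ℝ (curvTrace x N) p :=
  (hS.contDiffAt_curvTrace hp).differentiableAt (by simp)

lemma differentiableAt_gaussCurv (hS : SurfaceData U x N) (hp : p ∈ U) :
    DifferentiableAt ℝ (gaussCurv x N) p :=
  (hS.contDiffAt_gaussCurv hp).differentiableAt (by simp)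

lemma hasFDerivAt_firstForm (hS : SurfaceData U x N) (hp : p ∈ U) (u v : ℝ × ℝ) :
    HasFDerivAt (firstForm x u v) (fderiv ℝ (firstForm x u v) p) p :=
  ((hS.contDiffAt_firstForm hp u v).differentiableAt (by simp)).hasFDerivAt

lemma hasFDerivAt_secondForm (hS : SurfaceData U x N) (hp : p ∈ U) (u v : ℝ × ℝ) :
    HasFDerivAt (secondForm x N u v) (fderiv ℝ (secondForm x N u v) p) p :=
  ((hS.contDiffAt_secondForm hp u v).differentiableAt (by simp)).hasFDerivAt

lemma fderiv_firstForm_self (hS : SurfaceData U x N) (hp : p ∈ U) (u z : ℝ × ℝ) :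
    fderiv ℝ (firstForm x u u) p z = 2 * ⟪secondDeriv x p z u, fderiv ℝ x p u⟫_ℝ := by
  refine (fderiv_inner_apply ℝ (hS.differentiableAt_dx hp u) (hS.differentiableAt_dx hp u) z).trans
    ?_
  rw [secondDeriv, real_inner_comm]
  ring

lemma fderiv_secondForm (hS : SurfaceData U x N) (hp : p ∈ U) (u v z : ℝ × ℝ) :
    fderiv ℝ (secondForm x N u v) p z = -⟪secondDeriv N p z u, fderiv ℝ x p v⟫_ℝ -
      ⟪secondDeriv x p z v, fderiv ℝ N p u⟫_ℝ := by
  have h := ((hS.differentiableAt_dN hp u).inner ℝ (hS.differentiableAt_dx hp v)).hasFDerivAt.neg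
  refine (congrArg (fun L => L z) h.fderiv).trans ?_
  rw [neg_apply, fderiv_inner_apply ℝ (hS.differentiableAt_dN hp u) (hS.differentiableAt_dx hp v),
    secondDeriv, secondDeriv, real_inner_comm (fderiv ℝ N p u)]
  ring

end SurfaceData

namespace PrincipalFrame

variable {U : Set (ℝ × ℝ)} {x N : ℝ × ℝ → E3} {p ξ₁ ξ₂ : ℝ × ℝ} {κ₁ κ₂ : ℝ}

lemma curvTrace_eq (h : PrincipalFrame x N p ξ₁ ξ₂ κ₁ κ₂) (hS : SurfaceData U x N) (hp : p ∈ U) :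
    curvTrace x N p = κ₁ + κ₂ := by
  rw [curvTrace, h.trace_mul_gramDet hS hp, mul_div_cancel_right₀ _ (hS.gramDet_ne_zero hp)]

lemma gaussCurv_eq (h : PrincipalFrame x N p ξ₁ ξ₂ κ₁ κ₂) (hS : SurfaceData U x N) (hp : p ∈ U) :
    gaussCurv x N p = κ₁ * κ₂ := by
  rw [gaussCurv, h.det_mul_gramDet hS hp, mul_div_cancel_right₀ _ (hS.gramDet_ne_zero hp)]

/-- The derivatives of the second fundamental form and of the metric along a principal direction
combine to the Codazzi form. -/
lemma fderiv_forms (h : PrincipalFrame x N p ξ₁ ξ₂ κ₁ κ₂) (hS : SurfaceData U x N) (hp : p ∈ U)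
    (z : ℝ × ℝ) :
    fderiv ℝ (secondForm x N ξ₁ ξ₁) p z =
        κ₁ * fderiv ℝ (firstForm x ξ₁ ξ₁) p z - codazziForm x N p z ξ₁ ξ₁ ∧
      fderiv ℝ (secondForm x N ξ₂ ξ₂) p z =
        κ₂ * fderiv ℝ (firstForm x ξ₂ ξ₂) p z - codazziForm x N p z ξ₂ ξ₂ := by
  simp only [hS.fderiv_secondForm hp, hS.fderiv_firstForm_self hp, codazziForm, h.eig₁, h.eig₂,
    real_inner_smul_right]
  constructor <;> ring

lemma forms_self (h : PrincipalFrame x N p ξ₁ ξ₂ κ₁ κ₂) :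
    firstForm x ξ₁ ξ₁ p = 1 ∧ firstForm x ξ₂ ξ₂ p = 1 ∧ firstForm x ξ₁ ξ₂ p = 0 ∧
      secondForm x N ξ₁ ξ₁ p = κ₁ ∧ secondForm x N ξ₂ ξ₂ p = κ₂ ∧
      secondForm x N ξ₁ ξ₂ p = 0 := by
  simp [firstForm, secondForm, h.orth, h.eig₁, h.eig₂, h.norm_eq_one₁, h.norm_eq_one₂,
    real_inner_smul_left]

lemma fderiv_curvTrace (h : PrincipalFrame x N p ξ₁ ξ₂ κ₁ κ₂) (hS : SurfaceData U x N)
    (hp : p ∈ U) (z : ℝ × ℝ) :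
    fderiv ℝ (curvTrace x N) p z =
      -(codazziForm x N p z ξ₁ ξ₁ + codazziForm x N p z ξ₂ ξ₂) := by
  have hE := hS.hasFDerivAt_firstForm hp
  have hL := hS.hasFDerivAt_secondForm hp
  obtain ⟨f1, f2, f3, s1, s2, s3⟩ := h.forms_self
  obtain ⟨d1, d2⟩ := h.fderiv_forms hS hp z
  have h1 := ((((hL ξ₁ ξ₁).mul (hE ξ₂ ξ₂)).sub (((hL ξ₁ ξ₂).mul (hE ξ₁ ξ₂)).const_mul 2)).add
    ((hL ξ₂ ξ₂).mul (hE ξ₁ ξ₁))).fderiv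
  have h2 := ((hS.differentiableAt_curvTrace hp).hasFDerivAt.mul
    (((hE ξ₁ ξ₁).mul (hE ξ₂ ξ₂)).sub ((hE ξ₁ ξ₂).pow 2))).fderiv
  have h3 := congrArg (fun L => L z) (h1.symm.trans ((hS.fderiv_congr (fun y hy => by
    obtain ⟨_, _, _, _, hy'⟩ := hS.exists_principalFrame hy
    have := hy'.trace_mul_gramDet hS hy ξ₁ ξ₂
    rw [← hy'.curvTrace_eq hS hy] at this
    exact this) hp).trans h2))
  simp [f1, f2, f3, s1, s2, s3, d1, d2, h.curvTrace_eq hS hp] at h3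
  linarith

lemma fderiv_gaussCurv (h : PrincipalFrame x N p ξ₁ ξ₂ κ₁ κ₂) (hS : SurfaceData U x N)
    (hp : p ∈ U) (z : ℝ × ℝ) :
    fderiv ℝ (gaussCurv x N) p z =
      -(κ₂ * codazziForm x N p z ξ₁ ξ₁ + κ₁ * codazziForm x N p z ξ₂ ξ₂) := by
  have hE := hS.hasFDerivAt_firstForm hp
  have hL := hS.hasFDerivAt_secondForm hp
  obtain ⟨f1, f2, f3, s1, s2, s3⟩ := h.forms_self
  obtain ⟨d1, d2⟩ := h.fderiv_forms hS hp z
  have h1 := (((hL ξ₁ ξ₁).mul (hL ξ₂ ξ₂)).sub ((hL ξ₁ ξ₂).pow 2)).fderiv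
  have h2 := ((hS.differentiableAt_gaussCurv hp).hasFDerivAt.mul
    (((hE ξ₁ ξ₁).mul (hE ξ₂ ξ₂)).sub ((hE ξ₁ ξ₂).pow 2))).fderiv
  have h3 := congrArg (fun L => L z) (h1.symm.trans ((hS.fderiv_congr (fun y hy => by
    obtain ⟨_, _, _, _, hy'⟩ := hS.exists_principalFrame hy
    have := hy'.det_mul_gramDet hS hy ξ₁ ξ₂
    rw [← hy'.gaussCurv_eq hS hy] at this
    exact this) hp).trans h2))
  simp [f1, f2, f3, s1, s2, s3, d1, d2, h.gaussCurv_eq hS hp] at h3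
  linarith

end PrincipalFrame

end PrincipalFrames

section NecessaryConditions

lemma PrincipalFrame.symm {x N : ℝ × ℝ → E3} {p ξ₁ ξ₂ : ℝ × ℝ} {κ₁ κ₂ : ℝ}
    (h : PrincipalFrame x N p ξ₁ ξ₂ κ₁ κ₂) : PrincipalFrame x N p ξ₂ ξ₁ κ₂ κ₁ :=
  ⟨h.norm₂, h.norm₁, by rw [real_inner_comm, h.orth], h.eig₂, h.eig₁⟩

lemma Continuous.eq_zero_of_forall_ne {f : ℝ → ℝ} (hf : Continuous f) (h : ∀ t, t ≠ 0 → f t = 0) :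
    f 0 = 0 := by
  have h1 : Set.EqOn f (fun _ => 0) (closure {0}ᶜ) :=
    Set.EqOn.closure (fun t ht => h t ht) hf continuous_const
  rw [closure_compl_singleton] at h1
  exact h1 (Set.mem_univ 0)

namespace SurfaceData

variable {U : Set (ℝ × ℝ)} {x N : ℝ × ℝ → E3} {p ξ₁ ξ₂ : ℝ × ℝ} {κ₁ κ₂ : ℝ}

/-- The first-order and second-order expansions in `t` of the Maslovian condition along the
normal line over `p`. -/
lemma maslovian_expansion (hS : SurfaceData U x N) (hp : p ∈ U)
    (h : PrincipalFrame x N p ξ₁ ξ₂ κ₁ κ₂)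
    (hM : ∀ t H, IsMeanCurvAt (nbi x N) (p, t) H → MaslovianAt (nbi x N) (p, t) H)
    {T₁ T₂ T₃ T₄ : ℝ}
    (hT₁ : T₁ = codazziForm x N p ξ₁ ξ₁ ξ₁) (hT₂ : T₂ = codazziForm x N p ξ₁ ξ₁ ξ₂)
    (hT₃ : T₃ = codazziForm x N p ξ₁ ξ₂ ξ₂) (hT₄ : T₄ = codazziForm x N p ξ₂ ξ₂ ξ₂) :
    κ₁ + κ₂ ≠ 0 ∧ κ₁ * (T₁ + T₃) = 0 ∧
      (T₁ + T₃ = 0 → T₂ + T₄ = 0 → κ₁ * ((κ₂ - κ₁) * T₁) = 0) := by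
  have key := fun t => (hS.forall_maslovianAt_nbi_iff hp h t rfl rfl hT₁ hT₂ hT₃ hT₄ rfl rfl rfl).1
    (hM t)
  have hm : κ₁ + κ₂ ≠ 0 := by
    intro h0
    have h1 := (key 0).1
    simp [h0] at h1
  have hpos : ∀ κ t : ℝ, 1 + t ^ 2 * κ ^ 2 ≠ 0 := fun κ t => by positivity
  have hcont : ∀ κ : ℝ, Continuous fun t : ℝ => (1 + t ^ 2 * κ ^ 2)⁻¹ := fun κ =>
    Continuous.inv₀ (by fun_prop) (hpos κ)
  set r₁ : ℝ → ℝ := fun t => (1 + t ^ 2 * κ₁ ^ 2)⁻¹ with hr₁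
  set r₂ : ℝ → ℝ := fun t => (1 + t ^ 2 * κ₂ ^ 2)⁻¹ with hr₂
  have c₁ : Continuous r₁ := hcont κ₁
  have c₂ : Continuous r₂ := hcont κ₂
  refine ⟨hm, ?_, fun h13 h24 => ?_⟩
  · set A₁ : ℝ → ℝ := fun t => r₁ t * T₁ + r₂ t * T₃ with hA₁
    set A₂ : ℝ → ℝ := fun t => r₁ t * T₂ + r₂ t * T₄ with hA₂
    set B : ℝ → ℝ := fun t => -(r₁ t * κ₁ + r₂ t * κ₂) with hB
    have hA₁c : Continuous A₁ := by fun_prop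
    have hA₂c : Continuous A₂ := by fun_prop
    have hBc : Continuous B := by fun_prop
    have hlim := Continuous.eq_zero_of_forall_ne (f := fun t =>
      t ^ 2 * ((r₁ t ^ 2 * A₁ t ^ 2 * T₁ + 2 * r₁ t * r₂ t * A₁ t * A₂ t * T₂ +
        r₂ t ^ 2 * A₂ t ^ 2 * T₃) * B t + (κ₁ * r₁ t ^ 2 * A₁ t ^ 2 + κ₂ * r₂ t ^ 2 * A₂ t ^ 2) *
        A₁ t) - 2 * r₁ t * A₁ t * B t ^ 2 * κ₁) (by fun_prop) (fun t ht => by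
      obtain ⟨-, l, h1, -, h3⟩ := key t
      refine mul_left_cancel₀ ht ?_
      change t * (r₁ t ^ 2 * (t * A₁ t) ^ 2 * T₁ + 2 * r₁ t * r₂ t * (t * A₁ t) * (t * A₂ t) * T₂ +
        r₂ t ^ 2 * (t * A₂ t) ^ 2 * T₃) - 2 * r₁ t * (t * A₁ t) * B t * κ₁ = l * (t * A₁ t) at h1
      change -(κ₁ * r₁ t ^ 2 * (t * A₁ t) ^ 2 + κ₂ * r₂ t ^ 2 * (t * A₂ t) ^ 2) = l * B t at h3
      linear_combination B t * h1 - t * A₁ t * h3)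
    simp [hA₁, hB, hr₁, hr₂] at hlim
    rcases hlim with (h1 | h1) | h1
    · rw [h1, mul_zero]
    · exact absurd (by linarith) hm
    · rw [h1, zero_mul]
  · obtain rfl : T₃ = -T₁ := by linarith
    obtain rfl : T₄ = -T₂ := by linarith
    have hdiff : ∀ t, r₁ t - r₂ t = t ^ 2 * (r₁ t * r₂ t * (κ₂ ^ 2 - κ₁ ^ 2)) := fun t => by
      have h1 := hpos κ₁ t
      have h2 := hpos κ₂ t
      simp only [hr₁, hr₂]
      field_simp
      ring
    set A₁ : ℝ → ℝ := fun t => r₁ t * r₂ t * (κ₂ ^ 2 - κ₁ ^ 2) * T₁ with hA₁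
    set A₂ : ℝ → ℝ := fun t => r₁ t * r₂ t * (κ₂ ^ 2 - κ₁ ^ 2) * T₂ with hA₂
    set B : ℝ → ℝ := fun t => -(r₁ t * κ₁ + r₂ t * κ₂) with hB
    have hA₁c : Continuous A₁ := by fun_prop
    have hA₂c : Continuous A₂ := by fun_prop
    have hBc : Continuous B := by fun_prop
    have hlim := Continuous.eq_zero_of_forall_ne (f := fun t =>
      t ^ 2 * (t ^ 2 * ((r₁ t ^ 2 * A₁ t ^ 2 * T₁ + 2 * r₁ t * r₂ t * A₁ t * A₂ t * T₂ -
        r₂ t ^ 2 * A₂ t ^ 2 * T₁) * B t) + t ^ 4 * ((κ₁ * r₁ t ^ 2 * A₁ t ^ 2 +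
        κ₂ * r₂ t ^ 2 * A₂ t ^ 2) * A₁ t)) - 2 * r₁ t * A₁ t * B t ^ 2 * κ₁) (by fun_prop)
      (fun t ht => by
      obtain ⟨-, l, h1, -, h3⟩ := key t
      refine mul_left_cancel₀ (pow_ne_zero 3 ht) ?_
      have e1 : t * (r₁ t * T₁ + r₂ t * -T₁) = t ^ 3 * A₁ t := by
        linear_combination t * T₁ * hdiff t
      have e2 : t * (r₁ t * T₂ + r₂ t * -T₂) = t ^ 3 * A₂ t := by
        linear_combination t * T₂ * hdiff t
      change t * (r₁ t ^ 2 * (t * (r₁ t * T₁ + r₂ t * -T₁)) ^ 2 * T₁ +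
        2 * r₁ t * r₂ t * (t * (r₁ t * T₁ + r₂ t * -T₁)) * (t * (r₁ t * T₂ + r₂ t * -T₂)) * T₂ +
        r₂ t ^ 2 * (t * (r₁ t * T₂ + r₂ t * -T₂)) ^ 2 * -T₁) -
        2 * r₁ t * (t * (r₁ t * T₁ + r₂ t * -T₁)) * B t * κ₁ =
        l * (t * (r₁ t * T₁ + r₂ t * -T₁)) at h1
      change -(κ₁ * r₁ t ^ 2 * (t * (r₁ t * T₁ + r₂ t * -T₁)) ^ 2 +
        κ₂ * r₂ t ^ 2 * (t * (r₁ t * T₂ + r₂ t * -T₂)) ^ 2) = l * B t at h3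
      rw [e1, e2] at h1 h3
      linear_combination B t * h1 - t ^ 3 * A₁ t * h3)
    simp only [hA₁, hB, hr₁, hr₂] at hlim
    refine (mul_eq_zero.1 (?_ : 2 * (κ₁ + κ₂) ^ 3 * (κ₁ * ((κ₂ - κ₁) * T₁)) = 0)).resolve_left
      (by simpa using hm)
    norm_num at hlim
    rcases hlim with ((h1 | h1) | h1) | h1
    · linear_combination 2 * (κ₁ + κ₂) ^ 2 * κ₁ * T₁ * h1
    · rw [h1]; ring
    · exact absurd (by linarith) hm
    · rw [h1]; ring

lemma maslovian_curvTrace_ne_zero (hS : SurfaceData U x N) (hp : p ∈ U)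
    (hM : ∀ t H, IsMeanCurvAt (nbi x N) (p, t) H → MaslovianAt (nbi x N) (p, t) H) :
    curvTrace x N p ≠ 0 := by
  obtain ⟨ξ₁, ξ₂, κ₁, κ₂, h⟩ := hS.exists_principalFrame hp
  rw [h.curvTrace_eq hS hp]
  exact (hS.maslovian_expansion hp h hM rfl rfl rfl rfl).1

lemma maslovian_fderiv_curvTrace (hS : SurfaceData U x N) (hp : p ∈ U)
    (hM : ∀ t H, IsMeanCurvAt (nbi x N) (p, t) H → MaslovianAt (nbi x N) (p, t) H)
    (h : PrincipalFrame x N p ξ₁ ξ₂ κ₁ κ₂) : κ₁ * fderiv ℝ (curvTrace x N) p ξ₁ = 0 := by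
  rw [h.fderiv_curvTrace hS hp, mul_neg, neg_eq_zero]
  exact (hS.maslovian_expansion hp h hM rfl rfl rfl rfl).2.1

lemma maslovian_fderiv_eq_zero (hS : SurfaceData U x N) (hp : p ∈ U)
    (hM : ∀ t H, IsMeanCurvAt (nbi x N) (p, t) H → MaslovianAt (nbi x N) (p, t) H)
    (hK : gaussCurv x N p ≠ 0) : fderiv ℝ (curvTrace x N) p = 0 := by
  obtain ⟨ξ₁, ξ₂, κ₁, κ₂, h⟩ := hS.exists_principalFrame hp
  rw [h.gaussCurv_eq hS hp] at hK
  exact h.clm_ext hS hp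
    ((mul_eq_zero.1 (hS.maslovian_fderiv_curvTrace hp hM h)).resolve_left (left_ne_zero_of_mul hK))
    ((mul_eq_zero.1 (hS.maslovian_fderiv_curvTrace hp hM h.symm)).resolve_left
      (right_ne_zero_of_mul hK))

lemma maslovian_fderiv_gaussCurv_eq_zero (hS : SurfaceData U x N) (hp : p ∈ U)
    (hM : ∀ t H, IsMeanCurvAt (nbi x N) (p, t) H → MaslovianAt (nbi x N) (p, t) H)
    (hK : gaussCurv x N p ≠ 0) : fderiv ℝ (gaussCurv x N) p = 0 := by
  have hm := hS.maslovian_fderiv_eq_zero hp hM hK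
  obtain ⟨ξ₁, ξ₂, κ₁, κ₂, h⟩ := hS.exists_principalFrame hp
  rw [h.gaussCurv_eq hS hp] at hK
  have key : ∀ {ξ₁ ξ₂ κ₁ κ₂}, PrincipalFrame x N p ξ₁ ξ₂ κ₁ κ₂ → κ₁ * κ₂ ≠ 0 →
      fderiv ℝ (gaussCurv x N) p ξ₁ = 0 := by
    intro ξ₁ ξ₂ κ₁ κ₂ h hK
    have h1 := h.fderiv_curvTrace hS hp ξ₁
    have h2 := h.symm.fderiv_curvTrace hS hp ξ₂
    rw [hm, zero_apply] at h1 h2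
    have e2 : codazziForm x N p ξ₂ ξ₁ ξ₁ = codazziForm x N p ξ₁ ξ₁ ξ₂ := by
      rw [hS.codazziForm_comm_left hp, hS.codazziForm_comm_right hp]
    have h3 := (hS.maslovian_expansion hp h hM rfl rfl rfl rfl).2.2 (by linarith) (by linarith)
    have h4 := (mul_eq_zero.1 h3).resolve_left (left_ne_zero_of_mul hK)
    rw [h.fderiv_gaussCurv hS hp]
    linear_combination -h4 - κ₁ * h1
  exact h.clm_ext hS hp (key h hK) (key h.symm (by rwa [mul_comm]))

/-- Either the Gauss curvature vanishes identically, or the principal curvatures are constant. -/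
lemma maslovian_dichotomy (hS : SurfaceData U x N)
    (hM : ∀ p ∈ U, ∀ t H, IsMeanCurvAt (nbi x N) (p, t) H → MaslovianAt (nbi x N) (p, t) H) :
    (∀ p ∈ U, gaussCurv x N p = 0) ∨ ∃ m K : ℝ, m ≠ 0 ∧ K ≠ 0 ∧
      ∀ p ∈ U, curvTrace x N p = m ∧ gaussCurv x N p = K := by
  by_cases h0 : ∀ p ∈ U, gaussCurv x N p = 0
  · exact Or.inl h0
  right
  push Not at h0
  obtain ⟨p₀, hp₀, hK₀⟩ := h0
  have hcont : ContinuousOn (gaussCurv x N) U := fun p hp =>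
    (hS.differentiableAt_gaussCurv hp).continuousAt.continuousWithinAt
  have hloc : ∀ p ∈ U, gaussCurv x N p ≠ 0 → ∀ᶠ y in nhds p, gaussCurv x N y = gaussCurv x N p := by
    intro p hp hK
    have h1 : ∀ᶠ y in nhds p, y ∈ U ∧ gaussCurv x N y ≠ 0 :=
      (hS.open_U.eventually_mem hp).and
        ((hS.differentiableAt_gaussCurv hp).continuousAt.eventually_ne hK)
    obtain ⟨ε, hε, hball⟩ := Metric.eventually_nhds_iff_ball.1 h1
    filter_upwards [Metric.ball_mem_nhds p hε] with y hy
    refine (convex_ball p ε).is_const_of_fderivWithin_eq_zero (𝕜 := ℝ) (fun z hz =>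
      (hS.differentiableAt_gaussCurv (hball z hz).1).differentiableWithinAt) (fun z hz => ?_) hy
      (Metric.mem_ball_self hε)
    rw [fderivWithin_of_isOpen Metric.isOpen_ball hz]
    exact hS.maslovian_fderiv_gaussCurv_eq_zero (hball z hz).1 (hM z (hball z hz).1) (hball z hz).2
  have hK : ∀ p ∈ U, gaussCurv x N p = gaussCurv x N p₀ := by
    have h1 : IsOpen (U ∩ gaussCurv x N ⁻¹' {gaussCurv x N p₀}ᶜ) :=
      hcont.isOpen_inter_preimage hS.open_U isOpen_compl_singleton
    have h2 : IsOpen (U ∩ gaussCurv x N ⁻¹' {gaussCurv x N p₀}) := by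
      rw [isOpen_iff_mem_nhds]
      rintro p ⟨hp, hpK⟩
      rw [Set.mem_preimage, Set.mem_singleton_iff] at hpK
      filter_upwards [hS.open_U.mem_nhds hp, hloc p hp (hpK ▸ hK₀)] with y hy hyK
      exact ⟨hy, hyK.trans hpK⟩
    intro p hp
    by_contra hne
    obtain ⟨y, -, ⟨-, hy1⟩, -, hy2⟩ := hS.conn_U.isPreconnected _ _ h2 h1
      (fun y hy => (em (gaussCurv x N y = gaussCurv x N p₀)).imp (fun h => ⟨hy, h⟩)
        fun h => ⟨hy, h⟩) ⟨p₀, hp₀, hp₀, rfl⟩ ⟨p, hp, hp, hne⟩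
    exact hy2 hy1
  refine ⟨curvTrace x N p₀, gaussCurv x N p₀, hS.maslovian_curvTrace_ne_zero hp₀ (hM p₀ hp₀), hK₀,
    fun p hp => ⟨?_, hK p hp⟩⟩
  exact hS.open_U.is_const_of_fderiv_eq_zero (𝕜 := ℝ) hS.conn_U.isPreconnected
    (fun y hy => (hS.differentiableAt_curvTrace hy).differentiableWithinAt)
    (fun y hy => hS.maslovian_fderiv_eq_zero hy (hM y hy) (by rw [hK y hy]; exact hK₀)) hp hp₀

end SurfaceData

end NecessaryConditions

section CurvatureFrames

lemma Orthonormal.inner_triple {E : Type*} [NormedAddCommGroup E] [InnerProductSpace ℝ E]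
    {a b c : E} (h : Orthonormal ℝ ![a, b, c]) :
    ⟪a, a⟫_ℝ = 1 ∧ ⟪b, b⟫_ℝ = 1 ∧ ⟪c, c⟫_ℝ = 1 ∧ ⟪a, b⟫_ℝ = 0 ∧ ⟪a, c⟫_ℝ = 0 ∧ ⟪b, c⟫_ℝ = 0 := by
  have h1 := orthonormal_iff_ite.1 h
  exact ⟨by simpa using h1 0 0, by simpa using h1 1 1, by simpa using h1 2 2, by simpa using h1 0 1,
    by simpa using h1 0 2, by simpa using h1 1 2⟩

namespace SurfaceData

variable {U : Set (ℝ × ℝ)} {x N : ℝ × ℝ → E3} {p : ℝ × ℝ}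

lemma mono (hS : SurfaceData U x N) {W : Set (ℝ × ℝ)} (hWU : W ⊆ U) (hW : IsOpen W)
    (hWc : IsConnected W) : SurfaceData W x N :=
  ⟨hW, hWc, hS.smooth_x.mono hWU, hS.smooth_N.mono hWU, fun p hp => hS.immersion p (hWU hp),
    fun p hp => hS.unit_N p (hWU hp), fun p hp => hS.normal_N p (hWU hp)⟩

/-- A property which holds near `p` holds on a neighbourhood to which the surface can be
restricted. -/
lemma exists_restrict (hS : SurfaceData U x N) (hp : p ∈ U) {P : ℝ × ℝ → Prop}
    (hP : ∀ᶠ y in nhds p, P y) :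
    ∃ W ⊆ U, p ∈ W ∧ SurfaceData W x N ∧ ∀ y ∈ W, P y := by
  obtain ⟨ε, hε, hball⟩ := Metric.eventually_nhds_iff_ball.1 ((hS.open_U.eventually_mem hp).and hP)
  exact ⟨Metric.ball p ε, fun y hy => (hball y hy).1, Metric.mem_ball_self hε,
    hS.mono (fun y hy => (hball y hy).1) Metric.isOpen_ball
      ((convex_ball p ε).isConnected ⟨p, Metric.mem_ball_self hε⟩), fun y hy => (hball y hy).2⟩

lemma exists_const (hS : SurfaceData U x N) {F : Type*} [NormedAddCommGroup F] [NormedSpace ℝ F]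
    {f : ℝ × ℝ → F} (hf : ∀ p ∈ U, HasFDerivAt f (0 : ℝ × ℝ →L[ℝ] F) p) :
    ∃ c, ∀ p ∈ U, f p = c := by
  obtain ⟨p₀, hp₀⟩ := hS.conn_U.nonempty
  exact ⟨f p₀, fun p hp => hS.open_U.is_const_of_fderiv_eq_zero (𝕜 := ℝ) hS.conn_U.isPreconnected
    (fun y hy => (hf y hy).differentiableAt.differentiableWithinAt) (fun y hy => (hf y hy).fderiv)
    hp hp₀⟩

lemma exists_principalFrame_of_eq (hS : SurfaceData U x N) (hp : p ∈ U) {α β : ℝ}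
    (hsum : curvTrace x N p = α + β) (hprod : gaussCurv x N p = α * β) :
    ∃ ξ₁ ξ₂, PrincipalFrame x N p ξ₁ ξ₂ α β := by
  obtain ⟨ξ₁, ξ₂, κ₁, κ₂, h⟩ := hS.exists_principalFrame hp
  rw [h.curvTrace_eq hS hp] at hsum
  rw [h.gaussCurv_eq hS hp] at hprod
  have h1 : (κ₁ - α) * (κ₁ - β) = 0 := by linear_combination κ₁ * hsum - hprod
  rcases mul_eq_zero.1 h1 with h2 | h2
  · obtain rfl : κ₁ = α := by linarith
    obtain rfl : κ₂ = β := by linarith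
    exact ⟨ξ₁, ξ₂, h⟩
  · obtain rfl : κ₁ = β := by linarith
    obtain rfl : κ₂ = α := by linarith
    exact ⟨ξ₂, ξ₁, h.symm⟩

/-- A totally umbilic surface with constant nonzero curvature lies in a sphere. -/
lemma inRoundSphere_of_umbilic (hS : SurfaceData U x N) {k : ℝ} (hk : k ≠ 0)
    (hdN : ∀ p ∈ U, fderiv ℝ N p = -k • fderiv ℝ x p) : InRoundSphere U x := by
  obtain ⟨c, hc⟩ := hS.exists_const (f := fun p => x p + k⁻¹ • N p) (fun p hp => by
    have h := (hS.differentiableAt_x hp).hasFDerivAt.add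
      ((hS.differentiableAt_N hp).hasFDerivAt.const_smul k⁻¹)
    rwa [hdN p hp, smul_smul, mul_neg, inv_mul_cancel₀ hk, neg_one_smul, add_neg_cancel] at h)
  refine ⟨c, |k⁻¹|, abs_pos.2 (inv_ne_zero hk), fun p hp => ?_⟩
  rw [← hc p hp, sub_add_cancel_left, norm_neg, norm_smul, hS.unit_N p hp, mul_one,
    Real.norm_eq_abs]

end SurfaceData

/-- `e₁, e₂` is a smooth orthonormal frame of principal directions, with principal curvatures
`α` and `β`, the latter being constant. -/
structure CurvFrame (W : Set (ℝ × ℝ)) (x N e₁ e₂ : ℝ × ℝ → E3) (α : ℝ × ℝ → ℝ) (β : ℝ) : Prop where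
  smooth₁ : ∀ p ∈ W, ContDiffAt ℝ (⊤ : ℕ∞) e₁ p
  smooth₂ : ∀ p ∈ W, ContDiffAt ℝ (⊤ : ℕ∞) e₂ p
  orth : ∀ p ∈ W, Orthonormal ℝ ![e₁ p, e₂ p, N p]
  dN_eq : ∀ p ∈ W, ∀ z, fderiv ℝ N p z =
    -(α p * ⟪fderiv ℝ x p z, e₁ p⟫_ℝ) • e₁ p - (β * ⟪fderiv ℝ x p z, e₂ p⟫_ℝ) • e₂ p

namespace SurfaceData

variable {U : Set (ℝ × ℝ)} {x N : ℝ × ℝ → E3} {p : ℝ × ℝ}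

/-- Away from umbilics there are smooth orthonormal frames of principal directions. -/
lemma exists_curvFrame (hS : SurfaceData U x N) (hp : p ∈ U) {α : ℝ × ℝ → ℝ} {β : ℝ}
    (hα : ∀ p ∈ U, ContDiffAt ℝ (⊤ : ℕ∞) α p) (hsum : ∀ p ∈ U, curvTrace x N p = α p + β)
    (hprod : ∀ p ∈ U, gaussCurv x N p = α p * β) (hne : α p ≠ β) :
    ∃ W ⊆ U, p ∈ W ∧ SurfaceData W x N ∧ ∃ e₁ e₂, CurvFrame W x N e₁ e₂ α β := by
  obtain ⟨ξ₁, ξ₂, h⟩ := hS.exists_principalFrame_of_eq hp (hsum p hp) (hprod p hp)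
  set f₁ : ℝ × ℝ → E3 := fun y => fderiv ℝ N y ξ₁ + β • fderiv ℝ x y ξ₁ with hf₁
  set f₂ : ℝ × ℝ → E3 := fun y => fderiv ℝ N y ξ₂ + α y • fderiv ℝ x y ξ₂ with hf₂
  have s₁ : ∀ y ∈ U, ContDiffAt ℝ (⊤ : ℕ∞) f₁ y := fun y hy =>
    ((hS.contDiffAt_N hy).fderiv_apply_const ξ₁).add
      (((hS.contDiffAt_x hy).fderiv_apply_const ξ₁).const_smul β)
  have s₂ : ∀ y ∈ U, ContDiffAt ℝ (⊤ : ℕ∞) f₂ y := fun y hy =>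
    ((hS.contDiffAt_N hy).fderiv_apply_const ξ₂).add
      ((hα y hy).smul ((hS.contDiffAt_x hy).fderiv_apply_const ξ₂))
  have hx₁ : fderiv ℝ x p ξ₁ ≠ 0 := fun h0 => by simpa [h0] using h.norm₁
  have hx₂ : fderiv ℝ x p ξ₂ ≠ 0 := fun h0 => by simpa [h0] using h.norm₂
  have n₁ : f₁ p ≠ 0 := by
    simp only [hf₁, h.eig₁, ← add_smul]
    exact smul_ne_zero (fun h0 => hne (by linarith)) hx₁
  have n₂ : f₂ p ≠ 0 := by
    simp only [hf₂, h.eig₂, ← add_smul]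
    exact smul_ne_zero (fun h0 => hne (by linarith)) hx₂
  obtain ⟨W, hWU, hpW, hSW, hW⟩ := hS.exists_restrict hp
    (((s₁ p hp).continuousAt.eventually_ne n₁).and ((s₂ p hp).continuousAt.eventually_ne n₂))
  refine ⟨W, hWU, hpW, hSW, fun y => ‖f₁ y‖⁻¹ • f₁ y, fun y => ‖f₂ y‖⁻¹ • f₂ y, ?_⟩
  have main : ∀ y ∈ W, ∃ ζ₁ ζ₂, ∃ σ τ : ℝ, PrincipalFrame x N y ζ₁ ζ₂ (α y) β ∧ σ ^ 2 = 1 ∧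
      τ ^ 2 = 1 ∧ ‖f₁ y‖⁻¹ • f₁ y = σ • fderiv ℝ x y ζ₁ ∧
      ‖f₂ y‖⁻¹ • f₂ y = τ • fderiv ℝ x y ζ₂ := by
    intro y hy
    have hyU := hWU hy
    obtain ⟨ζ₁, ζ₂, hζ⟩ := hS.exists_principalFrame_of_eq hyU (hsum y hyU) (hprod y hyU)
    have e₁ : f₁ y = ((β - α y) * ⟪fderiv ℝ x y ζ₁, fderiv ℝ x y ξ₁⟫_ℝ) • fderiv ℝ x y ζ₁ := by
      simp only [hf₁]
      conv_lhs => rw [hζ.eq_add hSW hy ξ₁]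
      simp only [map_add, map_smul, hζ.eig₁, hζ.eig₂]
      module
    have e₂ : f₂ y = ((α y - β) * ⟪fderiv ℝ x y ζ₂, fderiv ℝ x y ξ₂⟫_ℝ) • fderiv ℝ x y ζ₂ := by
      simp only [hf₂]
      conv_lhs => rw [hζ.eq_add hSW hy ξ₂]
      simp only [map_add, map_smul, hζ.eig₁, hζ.eig₂]
      module
    have unit : ∀ {f z : E3} {s : ℝ}, f ≠ 0 → ‖z‖ = 1 → f = s • z →
        (‖f‖⁻¹ * s) ^ 2 = 1 ∧ ‖f‖⁻¹ • f = (‖f‖⁻¹ * s) • z := by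
      rintro f z s hf hz rfl
      refine ⟨?_, by rw [smul_smul]⟩
      have hs : s ≠ 0 := fun h0 => hf (by rw [h0, zero_smul])
      rw [norm_smul, hz, mul_one, mul_pow, inv_pow, Real.norm_eq_abs, sq_abs,
        inv_mul_cancel₀ (pow_ne_zero 2 hs)]
    obtain ⟨u₁, v₁⟩ := unit (hW y hy).1 hζ.norm_eq_one₁ e₁
    obtain ⟨u₂, v₂⟩ := unit (hW y hy).2 hζ.norm_eq_one₂ e₂
    exact ⟨ζ₁, ζ₂, _, _, hζ, u₁, u₂, v₁, v₂⟩
  refine ⟨fun y hy => ?_, fun y hy => ?_, fun y hy => ?_, fun y hy z => ?_⟩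
  · exact (((s₁ y (hWU hy)).norm ℝ (hW y hy).1).inv (norm_ne_zero_iff.2 (hW y hy).1)).smul
      (s₁ y (hWU hy))
  · exact (((s₂ y (hWU hy)).norm ℝ (hW y hy).2).inv (norm_ne_zero_iff.2 (hW y hy).2)).smul
      (s₂ y (hWU hy))
  · obtain ⟨ζ₁, ζ₂, σ, τ, hζ, hσ, hτ, e₁, e₂⟩ := main y hy
    simp only [e₁, e₂]
    have h1 := hSW.normal_N y hy
    refine orthonormal_triple ?_ ?_ (hSW.inner_N_self hy) ?_ ?_ ?_ <;>
      simp only [real_inner_smul_left, real_inner_smul_right, hζ.norm₁, hζ.norm₂, hζ.orth,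
        real_inner_comm (N y), h1, mul_zero]
    · linarith
    · linarith
  · obtain ⟨ζ₁, ζ₂, σ, τ, hζ, hσ, hτ, e₁, e₂⟩ := main y hy
    simp only [e₁, e₂, real_inner_smul_right, smul_smul]
    conv_lhs => rw [hζ.eq_add hSW hy z]
    rw [map_add, map_smul, map_smul, hζ.eig₁, hζ.eig₂, smul_smul, smul_smul, sub_eq_add_neg,
      ← neg_smul, real_inner_comm (fderiv ℝ x y ζ₁), real_inner_comm (fderiv ℝ x y ζ₂)]
    congr 2
    · linear_combination (α y * ⟪fderiv ℝ x y ζ₁, fderiv ℝ x y z⟫_ℝ) * hσ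
    · linear_combination (β * ⟪fderiv ℝ x y ζ₂, fderiv ℝ x y z⟫_ℝ) * hτ

end SurfaceData

end CurvatureFrames

section StructureEquations

namespace CurvFrame

variable {W : Set (ℝ × ℝ)} {x N e₁ e₂ : ℝ × ℝ → E3} {α : ℝ × ℝ → ℝ} {β : ℝ} {p : ℝ × ℝ}

lemma differentiableAt₁ (h : CurvFrame W x N e₁ e₂ α β) (hp : p ∈ W) : DifferentiableAt ℝ e₁ p :=
  (h.smooth₁ p hp).differentiableAt (by simp)

lemma differentiableAt₂ (h : CurvFrame W x N e₁ e₂ α β) (hp : p ∈ W) : DifferentiableAt ℝ e₂ p :=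
  (h.smooth₂ p hp).differentiableAt (by simp)

lemma dx_eq (h : CurvFrame W x N e₁ e₂ α β) (hS : SurfaceData W x N) (hp : p ∈ W) (z : ℝ × ℝ) :
    fderiv ℝ x p z = ⟪fderiv ℝ x p z, e₁ p⟫_ℝ • e₁ p + ⟪fderiv ℝ x p z, e₂ p⟫_ℝ • e₂ p := by
  have h1 := (h.orth p hp).eq_sum_triple (fderiv ℝ x p z)
  rw [hS.normal_N p hp, zero_smul, add_zero, real_inner_comm, real_inner_comm _ (e₂ p)] at h1
  exact h1

lemma inner_dx (h : CurvFrame W x N e₁ e₂ α β) (hS : SurfaceData W x N) (hp : p ∈ W) (z : ℝ × ℝ)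
    (w : E3) : ⟪fderiv ℝ x p z, w⟫_ℝ = ⟪fderiv ℝ x p z, e₁ p⟫_ℝ * ⟪w, e₁ p⟫_ℝ +
      ⟪fderiv ℝ x p z, e₂ p⟫_ℝ * ⟪w, e₂ p⟫_ℝ := by
  conv_lhs => rw [h.dx_eq hS hp]
  rw [inner_add_left, real_inner_smul_left, real_inner_smul_left, real_inner_comm (e₁ p) w,
    real_inner_comm (e₂ p) w]

lemma inner_dN (h : CurvFrame W x N e₁ e₂ α β) (hp : p ∈ W) (z : ℝ × ℝ) (w : E3) :
    ⟪fderiv ℝ N p z, w⟫_ℝ = -(α p * (⟪fderiv ℝ x p z, e₁ p⟫_ℝ * ⟪w, e₁ p⟫_ℝ)) -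
      β * (⟪fderiv ℝ x p z, e₂ p⟫_ℝ * ⟪w, e₂ p⟫_ℝ) := by
  rw [h.dN_eq p hp, inner_sub_left, real_inner_smul_left, real_inner_smul_left,
    real_inner_comm (e₁ p) w, real_inner_comm (e₂ p) w]
  ring

lemma inner_dN₁ (h : CurvFrame W x N e₁ e₂ α β) (hp : p ∈ W) (z : ℝ × ℝ) :
    ⟪fderiv ℝ N p z, e₁ p⟫_ℝ = -(α p * ⟪fderiv ℝ x p z, e₁ p⟫_ℝ) := by
  obtain ⟨h11, -, -, h12, -, -⟩ := (h.orth p hp).inner_triple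
  rw [h.inner_dN hp, h11, h12]
  ring

lemma inner_dN₂ (h : CurvFrame W x N e₁ e₂ α β) (hp : p ∈ W) (z : ℝ × ℝ) :
    ⟪fderiv ℝ N p z, e₂ p⟫_ℝ = -(β * ⟪fderiv ℝ x p z, e₂ p⟫_ℝ) := by
  obtain ⟨-, h22, -, h12, -, -⟩ := (h.orth p hp).inner_triple
  rw [real_inner_comm] at h12
  rw [h.inner_dN hp, h22, h12]
  ring

lemma exists_dual (h : CurvFrame W x N e₁ e₂ α β) (hS : SurfaceData W x N) (hp : p ∈ W) :
    ∃ ξ₁ ξ₂, fderiv ℝ x p ξ₁ = e₁ p ∧ fderiv ℝ x p ξ₂ = e₂ p := by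
  obtain ⟨-, -, -, -, h13, h23⟩ := (h.orth p hp).inner_triple
  rw [real_inner_comm] at h13 h23
  obtain ⟨ξ₁, h1⟩ := hS.exists_fderiv_eq hp h13
  obtain ⟨ξ₂, h2⟩ := hS.exists_fderiv_eq hp h23
  exact ⟨ξ₁, ξ₂, h1, h2⟩

lemma inner_fderiv_eq_neg {f g : ℝ × ℝ → E3} {k : ℝ} (hS : SurfaceData W x N) (hp : p ∈ W)
    (hfg : ∀ p ∈ W, ⟪f p, g p⟫_ℝ = k) (hf : DifferentiableAt ℝ f p) (hg : DifferentiableAt ℝ g p)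
    (z : ℝ × ℝ) : ⟪fderiv ℝ f p z, g p⟫_ℝ = -⟪f p, fderiv ℝ g p z⟫_ℝ := by
  have h := congrArg (fun L => L z) (hS.fderiv_congr hfg hp)
  simp only [fderiv_inner_apply ℝ hf hg, fderiv_fun_const, Pi.zero_apply, zero_apply] at h
  linarith

lemma inner_de₁ (h : CurvFrame W x N e₁ e₂ α β) (hS : SurfaceData W x N) (hp : p ∈ W) (z : ℝ × ℝ) :
    ⟪fderiv ℝ e₁ p z, e₁ p⟫_ℝ = 0 ∧ ⟪fderiv ℝ e₁ p z, e₂ p⟫_ℝ = -⟪fderiv ℝ e₂ p z, e₁ p⟫_ℝ := by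
  constructor
  · have h1 := inner_fderiv_eq_neg hS hp (fun p hp => (h.orth p hp).inner_triple.1)
      (h.differentiableAt₁ hp) (h.differentiableAt₁ hp) z
    rw [real_inner_comm (fderiv ℝ e₁ p z) (e₁ p)] at h1
    linarith
  · rw [real_inner_comm (e₁ p)]
    exact inner_fderiv_eq_neg hS hp (fun p hp => (h.orth p hp).inner_triple.2.2.2.1)
      (h.differentiableAt₁ hp) (h.differentiableAt₂ hp) z

lemma inner_de₂ (h : CurvFrame W x N e₁ e₂ α β) (hS : SurfaceData W x N) (hp : p ∈ W) (z : ℝ × ℝ) :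
    ⟪fderiv ℝ e₂ p z, e₂ p⟫_ℝ = 0 := by
  have h1 := inner_fderiv_eq_neg hS hp (fun p hp => (h.orth p hp).inner_triple.2.1)
    (h.differentiableAt₂ hp) (h.differentiableAt₂ hp) z
  rw [real_inner_comm (fderiv ℝ e₂ p z) (e₂ p)] at h1
  linarith

lemma de₂_eq (h : CurvFrame W x N e₁ e₂ α β) (hS : SurfaceData W x N) (hp : p ∈ W) (z : ℝ × ℝ) :
    fderiv ℝ e₂ p z = ⟪fderiv ℝ e₂ p z, e₁ p⟫_ℝ • e₁ p + (β * ⟪fderiv ℝ x p z, e₂ p⟫_ℝ) • N p := by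
  have h1 := (h.orth p hp).eq_sum_triple (fderiv ℝ e₂ p z)
  have h2 := inner_fderiv_eq_neg hS hp (fun p hp => (h.orth p hp).inner_triple.2.2.2.2.2)
    (h.differentiableAt₂ hp) (hS.differentiableAt_N hp) z
  rw [real_inner_comm (fderiv ℝ N p z), h.inner_dN₂ hp, neg_neg] at h2
  rwa [real_inner_comm _ (e₂ p), h.inner_de₂ hS hp, real_inner_comm _ (N p), h2, zero_smul,
    add_zero, real_inner_comm] at h1

lemma codazzi₁ (h : CurvFrame W x N e₁ e₂ α β) (hS : SurfaceData W x N) (hp : p ∈ W)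
    (hα : DifferentiableAt ℝ α p) (u v : ℝ × ℝ) :
    (α p - β) * (⟪fderiv ℝ x p v, e₂ p⟫_ℝ * ⟪fderiv ℝ e₂ p u, e₁ p⟫_ℝ) -
        fderiv ℝ α p u * ⟪fderiv ℝ x p v, e₁ p⟫_ℝ =
      ⟪secondDeriv N p u v, e₁ p⟫_ℝ + α p * ⟪secondDeriv x p u v, e₁ p⟫_ℝ := by
  have hd := h.differentiableAt₁ hp
  have hx := hS.differentiableAt_dx hp v
  have h1 := congrArg (fun L => L u) (hS.fderiv_congr (fun p hp => h.inner_dN₁ hp v) hp)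
  simp only [fderiv_inner_apply ℝ (hS.differentiableAt_dN hp v) hd] at h1
  have h2 := congrArg (fun L => L u) (hα.hasFDerivAt.mul (hx.inner ℝ hd).hasFDerivAt).neg.fderiv
  simp only [neg_apply, add_apply, smul_apply, fderiv_inner_apply ℝ hx hd] at h2
  have h3 := h1.trans h2
  obtain ⟨h4, h5⟩ := h.inner_de₁ hS hp u
  rw [h.inner_dN hp, h.inner_dx hS hp v (fderiv ℝ e₁ p u), h4, h5] at h3
  simp only [secondDeriv, smul_eq_mul] at h3 ⊢
  linarith

lemma codazzi₂ (h : CurvFrame W x N e₁ e₂ α β) (hS : SurfaceData W x N) (hp : p ∈ W)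
    (u v : ℝ × ℝ) :
    (α p - β) * (⟪fderiv ℝ x p v, e₁ p⟫_ℝ * ⟪fderiv ℝ e₂ p u, e₁ p⟫_ℝ) =
      ⟪secondDeriv N p u v, e₂ p⟫_ℝ + β * ⟪secondDeriv x p u v, e₂ p⟫_ℝ := by
  have hd := h.differentiableAt₂ hp
  have hx := hS.differentiableAt_dx hp v
  have h1 := congrArg (fun L => L u) (hS.fderiv_congr (fun p hp => h.inner_dN₂ hp v) hp)
  simp only [fderiv_inner_apply ℝ (hS.differentiableAt_dN hp v) hd] at h1
  have h2 := congrArg (fun L => L u) ((hx.inner ℝ hd).hasFDerivAt.const_mul β).neg.fderiv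
  simp only [neg_apply, smul_apply, fderiv_inner_apply ℝ hx hd] at h2
  have h3 := h1.trans h2
  rw [h.inner_dN hp, h.inner_dx hS hp v (fderiv ℝ e₂ p u), h.inner_de₂ hS hp] at h3
  simp only [secondDeriv, smul_eq_mul] at h3 ⊢
  linarith

/-- The connection form of the frame in terms of the derivative of `α`. -/
lemma connection_eq (h : CurvFrame W x N e₁ e₂ α β) (hS : SurfaceData W x N) (hp : p ∈ W)
    (hα : DifferentiableAt ℝ α p) {ξ : ℝ × ℝ} (hξ : fderiv ℝ x p ξ = e₂ p)
    (z : ℝ × ℝ) : (α p - β) * ⟪fderiv ℝ e₂ p z, e₁ p⟫_ℝ =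
      -fderiv ℝ α p ξ * ⟪fderiv ℝ x p z, e₁ p⟫_ℝ := by
  obtain ⟨ξ₁, ξ₂, hξ₁, hξ₂⟩ := h.exists_dual hS hp
  obtain rfl : ξ = ξ₂ := hS.immersion p hp (hξ.trans hξ₂.symm)
  obtain ⟨h11, h22, -, h12, -, -⟩ := (h.orth p hp).inner_triple
  have h21 := h12
  rw [real_inner_comm] at h21
  have hcx := (hS.contDiffAt_x hp).secondDeriv_comm ξ ξ₁
  have hcN := (hS.contDiffAt_N hp).secondDeriv_comm ξ ξ₁
  have c1 := h.codazzi₁ hS hp hα ξ₁ ξ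
  rw [← hcx, ← hcN, ← h.codazzi₁ hS hp hα ξ ξ₁] at c1
  have c2 := h.codazzi₂ hS hp ξ₁ ξ
  rw [← hcx, ← hcN, ← h.codazzi₂ hS hp ξ ξ₁] at c2
  rw [hξ, hξ₁, h11, h21] at c2
  rw [hξ, hξ₁, h12, h21, h22, h11] at c1
  have c3 : (α p - β) * ⟪fderiv ℝ e₂ p ξ, e₁ p⟫_ℝ = 0 := by linarith
  have hz : z = ⟪fderiv ℝ x p z, e₁ p⟫_ℝ • ξ₁ + ⟪fderiv ℝ x p z, e₂ p⟫_ℝ • ξ :=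
    hS.immersion p hp (by rw [map_add, map_smul, map_smul, hξ, hξ₁]; exact h.dx_eq hS hp z)
  conv_lhs => rw [hz]
  rw [map_add, map_smul, map_smul, inner_add_left, real_inner_smul_left, real_inner_smul_left]
  linear_combination ⟪fderiv ℝ x p z, e₁ p⟫_ℝ * c1 + ⟪fderiv ℝ x p z, e₂ p⟫_ℝ * c3

/-- The second derivatives of `⟪dx, e₂⟫`. -/
lemma fderiv_inner_dx₂ (h : CurvFrame W x N e₁ e₂ α β) (hS : SurfaceData W x N) (hp : p ∈ W)
    (u v : ℝ × ℝ) : fderiv ℝ (fun y => ⟪fderiv ℝ x y v, e₂ y⟫_ℝ) p u =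
      ⟪secondDeriv x p u v, e₂ p⟫_ℝ +
        ⟪fderiv ℝ x p v, e₁ p⟫_ℝ * ⟪fderiv ℝ e₂ p u, e₁ p⟫_ℝ := by
  rw [fderiv_inner_apply ℝ (hS.differentiableAt_dx hp v) (h.differentiableAt₂ hp),
    h.inner_dx hS hp v (fderiv ℝ e₂ p u), h.inner_de₂ hS hp, secondDeriv]
  ring

/-- Two distinct constant principal curvatures cannot both be nonzero. -/
lemma mul_eq_zero_of_const {α : ℝ} (h : CurvFrame W x N e₁ e₂ (fun _ => α) β)
    (hS : SurfaceData W x N) (hp : p ∈ W) (hne : α ≠ β) : α * β = 0 := by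
  have hη : ∀ y ∈ W, ∀ z, ⟪fderiv ℝ e₂ y z, e₁ y⟫_ℝ = 0 := fun y hy z => by
    obtain ⟨ξ₁, ξ₂, hξ₁, hξ₂⟩ := h.exists_dual hS hy
    have h1 := h.connection_eq hS hy (differentiableAt_const α) hξ₂ z
    simp only [fderiv_fun_const, Pi.zero_apply, zero_apply, neg_zero, zero_mul] at h1
    exact (mul_eq_zero.1 h1).resolve_left (sub_ne_zero.2 hne)
  have hde : ∀ v, ∀ y ∈ W, fderiv ℝ e₂ y v = (β * ⟪fderiv ℝ x y v, e₂ y⟫_ℝ) • N y :=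
    fun v y hy => by rw [h.de₂_eq hS hy, hη y hy, zero_smul, zero_add]
  have key : ∀ u v, secondDeriv e₂ p u v = (β * ⟪fderiv ℝ x p v, e₂ p⟫_ℝ) • fderiv ℝ N p u +
      (β * ⟪secondDeriv x p u v, e₂ p⟫_ℝ) • N p := by
    intro u v
    have h1 := ((((hS.differentiableAt_dx hp v).inner ℝ (h.differentiableAt₂ hp)).hasFDerivAt.const_mul
      β).smul (hS.differentiableAt_N hp).hasFDerivAt).fderiv
    refine (congrArg (fun L => L u) ((hS.fderiv_congr (hde v) hp).trans h1)).trans ?_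
    simp [h.fderiv_inner_dx₂ hS hp, hη p hp]
  obtain ⟨ξ₁, ξ₂, hξ₁, hξ₂⟩ := h.exists_dual hS hp
  obtain ⟨h11, h22, -, h12, h13, -⟩ := (h.orth p hp).inner_triple
  rw [real_inner_comm] at h13
  have h1 := (key ξ₁ ξ₂).symm.trans (((h.smooth₂ p hp).secondDeriv_comm ξ₁ ξ₂).trans (key ξ₂ ξ₁))
  have h2 := congrArg (fun w => ⟪w, e₁ p⟫_ℝ) h1
  simp only [inner_add_left, real_inner_smul_left, h13, h.inner_dN₁ hp, hξ₁, hξ₂, h11, h12, h22,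
    (hS.contDiffAt_x hp).secondDeriv_comm ξ₁ ξ₂] at h2
  linarith

end CurvFrame

end StructureEquations

section FlatSurfaces

namespace CurvFrame

variable {W : Set (ℝ × ℝ)} {x N e₁ e₂ : ℝ × ℝ → E3} {μ : ℝ × ℝ → ℝ} {p : ℝ × ℝ}

lemma exists_coeff {α : ℝ × ℝ → ℝ} {β : ℝ} (h : CurvFrame W x N e₁ e₂ α β) (hS : SurfaceData W x N)
    (hμ : ∀ p ∈ W, ContDiffAt ℝ (⊤ : ℕ∞) μ p)
    (hμ₁ : ∀ p ∈ W, ∀ ξ, fderiv ℝ x p ξ = e₁ p → fderiv ℝ μ p ξ = 0) :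
    ∃ c : ℝ × ℝ → ℝ, (∀ p ∈ W, ContDiffAt ℝ (⊤ : ℕ∞) c p) ∧
      ∀ p ∈ W, ∀ z, fderiv ℝ μ p z = c p * ⟪fderiv ℝ x p z, e₂ p⟫_ℝ := by
  have hb : ∀ y ∈ W, ∀ v, ContDiffAt ℝ (⊤ : ℕ∞) (fun y => ⟪fderiv ℝ x y v, e₂ y⟫_ℝ) y :=
    fun y hy v => ((hS.contDiffAt_x hy).fderiv_apply_const v).inner ℝ (h.smooth₂ y hy)
  have hdμ : ∀ y ∈ W, ∃ k : ℝ, ∀ z, fderiv ℝ μ y z = k * ⟪fderiv ℝ x y z, e₂ y⟫_ℝ := by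
    intro y hy
    obtain ⟨ξ₁, ξ₂, hξ₁, hξ₂⟩ := h.exists_dual hS hy
    refine ⟨fderiv ℝ μ y ξ₂, fun z => ?_⟩
    have hz : z = ⟪fderiv ℝ x y z, e₁ y⟫_ℝ • ξ₁ + ⟪fderiv ℝ x y z, e₂ y⟫_ℝ • ξ₂ :=
      hS.immersion y hy (by rw [map_add, map_smul, map_smul, hξ₂, hξ₁]; exact h.dx_eq hS hy z)
    conv_lhs => rw [hz]
    rw [map_add, map_smul, map_smul, hμ₁ y hy ξ₁ hξ₁, smul_zero, zero_add, smul_eq_mul, mul_comm]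
  have hD : ∀ y ∈ W, ⟪fderiv ℝ x y (1, 0), e₂ y⟫_ℝ * ⟪fderiv ℝ x y (1, 0), e₂ y⟫_ℝ +
      ⟪fderiv ℝ x y (0, 1), e₂ y⟫_ℝ * ⟪fderiv ℝ x y (0, 1), e₂ y⟫_ℝ ≠ 0 := by
    intro y hy h0
    obtain ⟨h1, h2⟩ := (mul_self_add_mul_self_eq_zero).1 h0
    obtain ⟨-, ξ, -, hξ⟩ := h.exists_dual hS hy
    have h3 : ⟪fderiv ℝ x y ξ, e₂ y⟫_ℝ = 1 := by rw [hξ]; exact (h.orth y hy).inner_triple.2.1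
    have hξ' : ξ = ξ.1 • ((1, 0) : ℝ × ℝ) + ξ.2 • ((0, 1) : ℝ × ℝ) := by ext <;> simp
    rw [hξ', map_add, map_smul, map_smul, inner_add_left, real_inner_smul_left,
      real_inner_smul_left, h1, h2] at h3
    norm_num at h3
  refine ⟨fun y => (fderiv ℝ μ y (1, 0) * ⟪fderiv ℝ x y (1, 0), e₂ y⟫_ℝ +
    fderiv ℝ μ y (0, 1) * ⟪fderiv ℝ x y (0, 1), e₂ y⟫_ℝ) /
    (⟪fderiv ℝ x y (1, 0), e₂ y⟫_ℝ * ⟪fderiv ℝ x y (1, 0), e₂ y⟫_ℝ +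
      ⟪fderiv ℝ x y (0, 1), e₂ y⟫_ℝ * ⟪fderiv ℝ x y (0, 1), e₂ y⟫_ℝ), fun y hy => ?_,
    fun y hy z => ?_⟩
  · exact ((((hμ y hy).fderiv_apply_const _).mul (hb y hy _)).add
      (((hμ y hy).fderiv_apply_const _).mul (hb y hy _))).div
      (((hb y hy _).mul (hb y hy _)).add ((hb y hy _).mul (hb y hy _))) (hD y hy)
  · obtain ⟨k, hk⟩ := hdμ y hy
    have hk' : (fderiv ℝ μ y (1, 0) * ⟪fderiv ℝ x y (1, 0), e₂ y⟫_ℝ +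
        fderiv ℝ μ y (0, 1) * ⟪fderiv ℝ x y (0, 1), e₂ y⟫_ℝ) /
        (⟪fderiv ℝ x y (1, 0), e₂ y⟫_ℝ * ⟪fderiv ℝ x y (1, 0), e₂ y⟫_ℝ +
        ⟪fderiv ℝ x y (0, 1), e₂ y⟫_ℝ * ⟪fderiv ℝ x y (0, 1), e₂ y⟫_ℝ) = k := by
      rw [div_eq_iff (hD y hy), hk, hk]
      ring
    simp only [hk', hk z]

/-- On a flat surface whose curvature radius `μ` has gradient `c • e₂` along the rulings, `c` is
locally constant and the rulings satisfy `de₂ = -c dN`. -/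
lemma flat_structure (h : CurvFrame W x N e₁ e₂ (fun p => (μ p)⁻¹) 0) (hS : SurfaceData W x N)
    (hμ : ∀ p ∈ W, ContDiffAt ℝ (⊤ : ℕ∞) μ p) (hμ0 : ∀ p ∈ W, μ p ≠ 0) {c : ℝ × ℝ → ℝ}
    (hc : ∀ p ∈ W, ContDiffAt ℝ (⊤ : ℕ∞) c p)
    (hdμ : ∀ p ∈ W, ∀ z, fderiv ℝ μ p z = c p * ⟪fderiv ℝ x p z, e₂ p⟫_ℝ) (hp : p ∈ W) :
    fderiv ℝ c p = 0 ∧ fderiv ℝ e₂ p = -c p • fderiv ℝ N p := by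
  have hcd : ∀ y ∈ W, DifferentiableAt ℝ c y := fun y hy => (hc y hy).differentiableAt (by simp)
  have hη : ∀ y ∈ W, ∀ z, ⟪fderiv ℝ e₂ y z, e₁ y⟫_ℝ =
      c y * (μ y)⁻¹ * ⟪fderiv ℝ x y z, e₁ y⟫_ℝ := fun y hy z => by
    obtain ⟨ξ₁, ξ₂, hξ₁, hξ₂⟩ := h.exists_dual hS hy
    have hμd : DifferentiableAt ℝ μ y := (hμ y hy).differentiableAt (by simp)
    have h1 := h.connection_eq hS hy (hμd.inv (hμ0 y hy)) hξ₂ z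
    have h2 := hdμ y hy ξ₂
    rw [hξ₂, (h.orth y hy).inner_triple.2.1, mul_one] at h2
    have h4 : fderiv ℝ (fun p => (μ p)⁻¹) y = -(μ y ^ 2)⁻¹ • fderiv ℝ μ y :=
      ((hasDerivAt_inv (hμ0 y hy)).comp_hasFDerivAt y hμd.hasFDerivAt).fderiv
    rw [h4, smul_apply, h2, sub_zero, smul_eq_mul] at h1
    have h3 := hμ0 y hy
    field_simp at h1 ⊢
    linarith
  have hde : ∀ y ∈ W, fderiv ℝ e₂ y = -c y • fderiv ℝ N y := fun y hy => by
    refine ContinuousLinearMap.ext fun z => ?_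
    rw [smul_apply, h.de₂_eq hS hy, h.dN_eq y hy, hη y hy]
    module
  have hsym : ∀ y ∈ W, ∀ u v, fderiv ℝ c y u * ⟪fderiv ℝ x y v, e₂ y⟫_ℝ =
      fderiv ℝ c y v * ⟪fderiv ℝ x y u, e₂ y⟫_ℝ := by
    intro y hy u v
    have key : ∀ u v, secondDeriv μ y u v = c y * (⟪secondDeriv x y u v, e₂ y⟫_ℝ +
        ⟪fderiv ℝ x y v, e₁ y⟫_ℝ * ⟪fderiv ℝ e₂ y u, e₁ y⟫_ℝ) +
        fderiv ℝ c y u * ⟪fderiv ℝ x y v, e₂ y⟫_ℝ := by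
      intro u v
      have h1 := ((hcd y hy).hasFDerivAt.mul
        ((hS.differentiableAt_dx hy v).inner ℝ (h.differentiableAt₂ hy)).hasFDerivAt).fderiv
      refine (congrArg (fun L => L u)
        ((hS.fderiv_congr (fun y hy => hdμ y hy v) hy).trans h1)).trans ?_
      simp [h.fderiv_inner_dx₂ hS hy]
      ring
    have h1 := (key u v).symm.trans (((hμ y hy).secondDeriv_comm u v).trans (key v u))
    rw [(hS.contDiffAt_x hy).secondDeriv_comm u v, hη y hy, hη y hy] at h1
    linarith
  obtain ⟨ξ₁, ξ₂, hξ₁, hξ₂⟩ := h.exists_dual hS hp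
  obtain ⟨h11, h22, -, h12, -, -⟩ := (h.orth p hp).inner_triple
  have hQ : ∀ y ∈ W, ∀ v, fderiv ℝ (e₂ + c • N) y v = fderiv ℝ c y v • N y := fun y hy v => by
    rw [((h.differentiableAt₂ hy).hasFDerivAt.add
      ((hcd y hy).hasFDerivAt.smul (hS.differentiableAt_N hy).hasFDerivAt)).fderiv, hde y hy]
    simp
  have hQ2 : ∀ u v, secondDeriv (e₂ + c • N) p u v = fderiv ℝ c p v • fderiv ℝ N p u +
      secondDeriv c p u v • N p := by
    intro u v
    have hcv : DifferentiableAt ℝ (fun y => fderiv ℝ c y v) p :=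
      ((hc p hp).fderiv_apply_const v).differentiableAt (by simp)
    have h1 := (hcv.hasFDerivAt.smul (hS.differentiableAt_N hp).hasFDerivAt).fderiv
    refine (congrArg (fun L => L u)
        ((hS.fderiv_congr (fun y hy => hQ y hy v) hp).trans h1)).trans ?_
    simp [secondDeriv]
  have hQs : ContDiffAt ℝ (⊤ : ℕ∞) (e₂ + c • N) p :=
    (h.smooth₂ p hp).add ((hc p hp).smul (hS.contDiffAt_N hp))
  have h1 := (hQ2 ξ₁ ξ₂).symm.trans ((hQs.secondDeriv_comm ξ₁ ξ₂).trans (hQ2 ξ₂ ξ₁))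
  rw [(hc p hp).secondDeriv_comm ξ₁ ξ₂] at h1
  have h2 := congrArg (fun w => ⟪w, e₁ p⟫_ℝ) (add_right_cancel h1)
  have h21 := h12
  rw [real_inner_comm] at h21
  simp only [real_inner_smul_left, h.inner_dN₁ hp, hξ₁, hξ₂, h11, h21] at h2
  have c2 : fderiv ℝ c p ξ₂ = 0 := by
    have h3 := inv_ne_zero (hμ0 p hp)
    have h4 : fderiv ℝ c p ξ₂ * (μ p)⁻¹ = 0 := by linarith
    exact (mul_eq_zero.1 h4).resolve_right h3
  have c1 : fderiv ℝ c p ξ₁ = 0 := by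
    have h3 := hsym p hp ξ₁ ξ₂
    rw [hξ₁, hξ₂, h22, h12] at h3
    linarith
  refine ⟨ContinuousLinearMap.ext fun z => ?_, hde p hp⟩
  have hz : z = ⟪fderiv ℝ x p z, e₁ p⟫_ℝ • ξ₁ + ⟪fderiv ℝ x p z, e₂ p⟫_ℝ • ξ₂ :=
    hS.immersion p hp (by rw [map_add, map_smul, map_smul, hξ₂, hξ₁]; exact h.dx_eq hS hp z)
  rw [hz, map_add, map_smul, map_smul, c1, c2]
  simp

end CurvFrame

end FlatSurfaces

section MaslovianSurfaces

/-- The unit vector `e` spans the kernel of the shape operator at `p`, the other principal curvature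
being `μ⁻¹`. -/
structure IsRuling (x N : ℝ × ℝ → E3) (p : ℝ × ℝ) (μ : ℝ) (e : E3) : Prop where
  inner_self : ⟪e, e⟫_ℝ = 1
  inner_N : ⟪e, N p⟫_ℝ = 0
  inner_dN : ∀ z, ⟪e, fderiv ℝ N p z⟫_ℝ = 0
  dx_eq : ∀ z, fderiv ℝ x p z = ⟪fderiv ℝ x p z, e⟫_ℝ • e - μ • fderiv ℝ N p z

namespace SurfaceData

variable {U : Set (ℝ × ℝ)} {x N : ℝ × ℝ → E3} {p : ℝ × ℝ}

lemma inRoundSphere_of_const (hS : SurfaceData U x N) {m K : ℝ} (hK : K ≠ 0)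
    (hc : ∀ p ∈ U, curvTrace x N p = m ∧ gaussCurv x N p = K) : InRoundSphere U x := by
  obtain ⟨p, hp⟩ := hS.conn_U.nonempty
  obtain ⟨ξ₁, ξ₂, α, β, h⟩ := hS.exists_principalFrame hp
  have hsum : m = α + β := (hc p hp).1.symm.trans (h.curvTrace_eq hS hp)
  have hprod : K = α * β := (hc p hp).2.symm.trans (h.gaussCurv_eq hS hp)
  by_cases hne : α = β
  · subst hne
    have hα : α ≠ 0 := fun h0 => hK (by rw [hprod, h0, zero_mul])
    refine hS.inRoundSphere_of_umbilic hα fun y hy => ?_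
    obtain ⟨ζ₁, ζ₂, hζ⟩ := hS.exists_principalFrame_of_eq hy ((hc y hy).1.trans hsum)
      ((hc y hy).2.trans hprod)
    exact hζ.clm_ext hS hy hζ.eig₁ hζ.eig₂
  · obtain ⟨W, -, hpW, hSW, e₁, e₂, hF⟩ := hS.exists_curvFrame hp (α := fun _ => α) (β := β)
      (fun _ _ => contDiffAt_const) (fun y hy => (hc y hy).1.trans hsum)
      (fun y hy => (hc y hy).2.trans hprod) hne
    exact absurd (hprod.trans (hF.mul_eq_zero_of_const hSW hpW hne)) hK

lemma exists_ruling (hS : SurfaceData U x N) (hm : ∀ p ∈ U, curvTrace x N p ≠ 0)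
    (hK : ∀ p ∈ U, gaussCurv x N p = 0)
    (hd : ∀ p ∈ U, ∀ ξ₁ ξ₂ κ₁ κ₂, PrincipalFrame x N p ξ₁ ξ₂ κ₁ κ₂ →
      κ₁ * fderiv ℝ (curvTrace x N) p ξ₁ = 0) (hp : p ∈ U) :
    ∃ W ⊆ U, p ∈ W ∧ SurfaceData W x N ∧ ∃ (e : ℝ × ℝ → E3) (c : ℝ), ∀ y ∈ W,
      IsRuling x N y (curvTrace x N y)⁻¹ (e y) ∧
      (∀ z, fderiv ℝ (fun y => (curvTrace x N y)⁻¹) y z = c * ⟪fderiv ℝ x y z, e y⟫_ℝ) ∧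
      HasFDerivAt e (-c • fderiv ℝ N y) y := by
  obtain ⟨W, hWU, hpW, hSW, e₁, e₂, hF⟩ := hS.exists_curvFrame hp (α := curvTrace x N) (β := 0)
    (fun y hy => hS.contDiffAt_curvTrace hy) (fun y hy => (add_zero _).symm)
    (fun y hy => by rw [hK y hy, mul_zero]) (hm p hp)
  have hμ : ∀ y ∈ W, ContDiffAt ℝ (⊤ : ℕ∞) (fun y => (curvTrace x N y)⁻¹) y := fun y hy =>
    (hS.contDiffAt_curvTrace (hWU hy)).inv (hm y (hWU hy))
  have hμ0 : ∀ y ∈ W, (curvTrace x N y)⁻¹ ≠ 0 := fun y hy => inv_ne_zero (hm y (hWU hy))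
  have hF' : CurvFrame W x N e₁ e₂ (fun y => ((fun y => (curvTrace x N y)⁻¹) y)⁻¹) 0 := by
    simpa only [inv_inv] using hF
  obtain ⟨c, hc, hdμ⟩ := hF.exists_coeff hSW hμ fun y hy ξ hξ => by
    obtain ⟨ξ₁, ξ₂, hξ₁, hξ₂⟩ := hF.exists_dual hSW hy
    obtain rfl : ξ = ξ₁ := hSW.immersion y hy (hξ.trans hξ₁.symm)
    obtain ⟨h11, h22, -, h12, -, -⟩ := (hF.orth y hy).inner_triple
    have h21 := h12
    rw [real_inner_comm] at h21
    have hPF : PrincipalFrame x N y ξ ξ₂ (curvTrace x N y) 0 := by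
      refine ⟨by rw [hξ, h11], by rw [hξ₂, h22], by rw [hξ, hξ₂, h12], ?_, ?_⟩
      · rw [hF.dN_eq y hy, hξ, h11]; module
      · rw [hF.dN_eq y hy, hξ₂, h21]; module
    have h1 := (mul_eq_zero.1 (hd y (hWU hy) _ _ _ _ hPF)).resolve_left (hm y (hWU hy))
    have h2 : fderiv ℝ (fun y => (curvTrace x N y)⁻¹) y =
        -(curvTrace x N y ^ 2)⁻¹ • fderiv ℝ (curvTrace x N) y :=
      ((hasDerivAt_inv (hm y (hWU hy))).comp_hasFDerivAt y
        (hS.differentiableAt_curvTrace (hWU hy)).hasFDerivAt).fderiv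
    rw [h2, smul_apply, h1, smul_zero]
  have key := fun {y} (hy : y ∈ W) => hF'.flat_structure hSW hμ hμ0 hc hdμ hy
  obtain ⟨c₀, hc₀⟩ := hSW.exists_const fun y hy => by
    have h1 := ((hc y hy).differentiableAt (by simp)).hasFDerivAt
    rwa [(key hy).1] at h1
  refine ⟨W, hWU, hpW, hSW, e₂, c₀, fun y hy => ⟨?_, fun z => ?_, ?_⟩⟩
  · obtain ⟨h11, h22, -, h12, -, h23⟩ := (hF.orth y hy).inner_triple
    refine ⟨h22, h23, fun z => ?_, fun z => ?_⟩
    · rw [real_inner_comm, hF.inner_dN₂ hy]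
      ring
    · rw [hF.dN_eq y hy]
      conv_lhs => rw [hF.dx_eq hSW hy]
      rw [zero_mul, zero_smul, sub_zero, smul_smul, mul_neg,
        inv_mul_cancel_left₀ (hm y (hWU hy))]
      module
  · rw [hdμ y hy, hc₀ y hy]
  · have h1 := (hF.differentiableAt₂ hy).hasFDerivAt
    rwa [(key hy).2, hc₀ y hy] at h1

/-- Two tangent vectors with the same inner products with all tangent vectors agree. -/
lemma ext_inner_tangent (hS : SurfaceData U x N) (hp : p ∈ U) {v w : E3} (hv : ⟪v, N p⟫_ℝ = 0)
    (hw : ⟪w, N p⟫_ℝ = 0) (h : ∀ z, ⟪v, fderiv ℝ x p z⟫_ℝ = ⟪w, fderiv ℝ x p z⟫_ℝ) : v = w := by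
  have h0 : ⟪N p, v - w⟫_ℝ = 0 := by
    rw [inner_sub_right, real_inner_comm v, real_inner_comm w, hv, hw, sub_zero]
  obtain ⟨z, hz⟩ := hS.exists_fderiv_eq hp h0
  rw [← sub_eq_zero, ← inner_self_eq_zero (𝕜 := ℝ)]
  nth_rewrite 2 [← hz]
  rw [inner_sub_left, h z, sub_self]

lemma _root_.IsRuling.inner_smul_eq (hS : SurfaceData U x N) (hp : p ∈ U) {μ : ℝ} {e e' : E3}
    (h : IsRuling x N p μ e) (h' : IsRuling x N p μ e') (z : E3) :
    ⟪e, z⟫_ℝ • e = ⟪e', z⟫_ℝ • e' := by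
  obtain ⟨ζ, hζ⟩ := hS.exists_fderiv_eq hp (z := e') (by rw [real_inner_comm, h'.inner_N])
  have h1 := congrArg (fun v => ⟪e', v⟫_ℝ) (h.dx_eq ζ)
  simp only [hζ, inner_sub_right, inner_smul_right, h'.inner_self, h'.inner_dN] at h1
  have h2 : e' = ⟪e', e⟫_ℝ • e := by
    rw [← sub_eq_zero, ← inner_self_eq_zero (𝕜 := ℝ)]
    simp only [inner_sub_left, inner_sub_right, real_inner_smul_left, real_inner_smul_right,
      h.inner_self, h'.inner_self, real_inner_comm e' e]
    linarith
  conv_rhs => rw [h2]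
  rw [real_inner_smul_left, smul_smul]
  congr 1
  linear_combination ⟪e, z⟫_ℝ * h1

/-- The gradient of the curvature radius of a flat surface, together with its derivative. -/
lemma exists_grad (hS : SurfaceData U x N) {μ : ℝ × ℝ → ℝ}
    (hl : ∀ p ∈ U, ∃ W ⊆ U, p ∈ W ∧ SurfaceData W x N ∧ ∃ (e : ℝ × ℝ → E3) (c : ℝ), ∀ y ∈ W,
      IsRuling x N y (μ y) (e y) ∧ (∀ z, fderiv ℝ μ y z = c * ⟪fderiv ℝ x y z, e y⟫_ℝ) ∧
      HasFDerivAt e (-c • fderiv ℝ N y) y) :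
    ∃ (F : ℝ × ℝ → E3) (γ : ℝ), ∀ p ∈ U, ⟪F p, F p⟫_ℝ = γ ∧ ⟪F p, N p⟫_ℝ = 0 ∧
      HasFDerivAt F (-γ • fderiv ℝ N p) p ∧ (∀ z, fderiv ℝ μ p z = ⟪F p, fderiv ℝ x p z⟫_ℝ) ∧
      ∀ z, fderiv ℝ μ p z • F p - (μ p * γ) • fderiv ℝ N p z = γ • fderiv ℝ x p z := by
  have hex : ∀ p, ∃ v, p ∈ U → ⟪v, N p⟫_ℝ = 0 ∧
      ∀ z, ⟪v, fderiv ℝ x p z⟫_ℝ = fderiv ℝ μ p z := by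
    intro p
    by_cases hp : p ∈ U
    · obtain ⟨W, -, hpW, -, e, c, h⟩ := hl p hp
      obtain ⟨h1, h2, -⟩ := h p hpW
      refine ⟨c • e p, fun _ => ⟨?_, fun z => ?_⟩⟩
      · rw [real_inner_smul_left, h1.inner_N, mul_zero]
      · rw [h2, real_inner_smul_left, real_inner_comm]
    · exact ⟨0, fun h => absurd h hp⟩
  choose F hF using hex
  have hloc : ∀ p ∈ U, ∃ W ⊆ U, p ∈ W ∧ IsOpen W ∧ ∃ (e : ℝ × ℝ → E3) (c : ℝ), ∀ y ∈ W,
      F y = c • e y ∧ IsRuling x N y (μ y) (e y) ∧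
      (∀ z, fderiv ℝ μ y z = c * ⟪fderiv ℝ x y z, e y⟫_ℝ) ∧
      HasFDerivAt e (-c • fderiv ℝ N y) y := by
    intro p hp
    obtain ⟨W, hWU, hpW, hSW, e, c, h⟩ := hl p hp
    refine ⟨W, hWU, hpW, hSW.open_U, e, c, fun y hy => ⟨?_, h y hy⟩⟩
    obtain ⟨h1, h2, -⟩ := h y hy
    refine hS.ext_inner_tangent (hWU hy) (hF y (hWU hy)).1 ?_ fun z => ?_
    · rw [real_inner_smul_left, h1.inner_N, mul_zero]
    · rw [(hF y (hWU hy)).2, h2, real_inner_smul_left, real_inner_comm]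
  obtain ⟨γ, hγ⟩ := hS.exists_const (f := fun p => ⟪F p, F p⟫_ℝ) fun p hp => by
    obtain ⟨W, hWU, hpW, hW, e, c, h⟩ := hloc p hp
    refine (hasFDerivAt_const (c ^ 2) p).congr_of_eventuallyEq ?_
    filter_upwards [hW.mem_nhds hpW] with y hy
    rw [(h y hy).1, real_inner_smul_left, real_inner_smul_right, (h y hy).2.1.inner_self]
    ring
  refine ⟨F, γ, fun p hp => ⟨hγ p hp, (hF p hp).1, ?_, fun z => ((hF p hp).2 z).symm, fun z => ?_⟩⟩ <;>
    obtain ⟨W, hWU, hpW, hW, e, c, h⟩ := hloc p hp <;>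
    obtain ⟨h1, h2, h3, h4⟩ := h p hpW <;>
    have hc := hγ p hp <;>
    rw [h1, real_inner_smul_left, real_inner_smul_right, h2.inner_self, mul_one] at hc
  · have h5 := (h4.const_smul c).congr_of_eventuallyEq (f₁ := F)
      (by filter_upwards [hW.mem_nhds hpW] with y hy using (h y hy).1)
    rwa [smul_smul, mul_neg, hc] at h5
  · rw [h1, h3, ← hc]
    conv_rhs => rw [h2.dx_eq z]
    module

end SurfaceData

end MaslovianSurfaces

section Cones

lemma exists_rotation {w : E3} (hw : ‖w‖ = 1) : ∃ S : E3 ≃ₗᵢ[ℝ] E3,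
    LinearMap.det (S.toLinearEquiv : E3 →ₗ[ℝ] E3) = 1 ∧ S (EuclideanSpace.single 2 1) = w := by
  obtain ⟨b, hb⟩ := Orthonormal.exists_orthonormalBasis_extension_of_card_eq (𝕜 := ℝ) (E := E3)
    (ι := Fin 3) (by simp) (v := fun _ => w) (s := {2}) (by
      refine ⟨fun i => hw, fun i j hij => absurd (Subsingleton.elim i j) hij⟩)
  have hS : b.repr.symm (EuclideanSpace.single 2 1) = w := by
    rw [b.repr_symm_single]
    exact hb 2 rfl
  have hdet : |LinearMap.det (b.repr.symm.toLinearEquiv : E3 →ₗ[ℝ] E3)| = 1 := by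
    rw [← LinearMap.normDet_eq_abs_det]
    exact b.repr.symm.toLinearIsometry.normDet_eq_one
  rcases eq_or_eq_neg_of_abs_eq hdet with h1 | h1
  · exact ⟨_, h1, hS⟩
  · set K : Submodule ℝ E3 := (ℝ ∙ (EuclideanSpace.single 0 1 : E3))ᗮ
    have hK : LinearMap.det K.reflection.toLinearMap = -1 := by
      rw [Submodule.det_reflection, Submodule.orthogonal_orthogonal,
        finrank_span_singleton (by simp), pow_one]
    refine ⟨K.reflection.trans b.repr.symm, ?_, ?_⟩
    · have h2 : (((K.reflection.trans b.repr.symm).toLinearEquiv) : E3 →ₗ[ℝ] E3) =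
          (b.repr.symm.toLinearEquiv : E3 →ₗ[ℝ] E3) ∘ₗ K.reflection.toLinearMap := rfl
      rw [h2, LinearMap.det_comp, h1, hK]
      norm_num
    · rw [LinearIsometryEquiv.trans_apply, Submodule.reflection_mem_subspace_eq_self, hS]
      rw [Submodule.mem_orthogonal_singleton_iff_inner_right, EuclideanSpace.inner_single_left]
      simp

lemma exists_cos_sin_eq {a b : ℝ} (h : a ^ 2 + b ^ 2 = 1) :
    ∃ θ, a = Real.cos θ ∧ b = Real.sin θ := by
  have hn : ‖(⟨a, b⟩ : ℂ)‖ = 1 := by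
    rw [← sq_eq_sq₀ (norm_nonneg _) zero_le_one, ← Complex.normSq_eq_norm_sq, Complex.normSq_mk]
    linarith
  refine ⟨Complex.arg ⟨a, b⟩, ?_, ?_⟩
  · simpa [hn] using (Complex.norm_mul_cos_arg ⟨a, b⟩).symm
  · simpa [hn] using (Complex.norm_mul_sin_arg ⟨a, b⟩).symm

lemma mem_coneSet_iff {r : ℝ} (hr : r ≠ 0) (y : E3) :
    y ∈ coneSet r ↔ 0 < y 2 ∧ (1 + r ^ 2) * y 2 ^ 2 = ⟪y, y⟫_ℝ := by
  have hq : (0 : ℝ) < Real.sqrt (r ^ 2 + 1) := Real.sqrt_pos.2 (by positivity)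
  have hq2 : Real.sqrt (r ^ 2 + 1) ^ 2 = r ^ 2 + 1 := Real.sq_sqrt (by positivity)
  have hyy : ⟪y, y⟫_ℝ = y 0 ^ 2 + y 1 ^ 2 + y 2 ^ 2 := by
    rw [PiLp.inner_apply, Fin.sum_univ_three]
    simp [pow_two]
  rw [hyy]
  constructor
  · rintro ⟨s, θ, hs, h0, h1, h2⟩
    refine ⟨by rw [h2]; positivity, ?_⟩
    have h3 := Real.sin_sq_add_cos_sq θ
    rw [h0, h1, h2]
    simp only [div_pow, hq2, mul_pow]
    field_simp
    linear_combination (-r ^ 2) * h3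
  · rintro ⟨h2, h⟩
    obtain ⟨θ, hc, hs⟩ := exists_cos_sin_eq (a := y 0 / (r * y 2)) (b := y 1 / (r * y 2)) (by
      have h3 := h2.ne'
      field_simp
      linarith)
    have h3 : r * y 2 ≠ 0 := mul_ne_zero hr h2.ne'
    rw [div_eq_iff h3] at hc hs
    refine ⟨y 2 * Real.sqrt (r ^ 2 + 1), θ, by positivity, ?_, ?_, ?_⟩
    · rw [hc]; field_simp
    · rw [hs]; field_simp
    · field_simp

lemma inCircularCone_iff {U : Set (ℝ × ℝ)} {x : ℝ × ℝ → E3} :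
    InCircularCone U x ↔ ∃ (r : ℝ) (x₀ w : E3), r ≠ 0 ∧ ‖w‖ = 1 ∧ ∀ p ∈ U,
      0 < ⟪w, x p - x₀⟫_ℝ ∧ (1 + r ^ 2) * ⟪w, x p - x₀⟫_ℝ ^ 2 = ⟪x p - x₀, x p - x₀⟫_ℝ := by
  have key : ∀ (S : E3 ≃ₗᵢ[ℝ] E3) (y : E3), ⟪S (EuclideanSpace.single 2 1), S y⟫_ℝ = y 2 := by
    intro S y
    rw [S.inner_map_map, EuclideanSpace.inner_single_left]
    simp
  constructor
  · rintro ⟨r, hr, Φ, ⟨S, c, -, hΦ⟩, h⟩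
    refine ⟨r, c, S (EuclideanSpace.single 2 1), hr, by simp, fun p hp => ?_⟩
    obtain ⟨y, hy, hyx⟩ := h p hp
    rw [← hyx, hΦ, add_sub_cancel_right, key, S.inner_map_map]
    exact (mem_coneSet_iff hr y).1 hy
  · rintro ⟨r, x₀, w, hr, hw, h⟩
    obtain ⟨S, hdet, hS⟩ := exists_rotation hw
    refine ⟨r, hr, fun y => S y + x₀, ⟨S, x₀, hdet, fun _ => rfl⟩, fun p hp => ?_⟩
    refine ⟨S.symm (x p - x₀), (mem_coneSet_iff hr _).2 ?_, by simp⟩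
    rw [← key S, hS, S.apply_symm_apply, S.symm.inner_map_map]
    exact h p hp

end Cones

section Classification

namespace SurfaceData

variable {U : Set (ℝ × ℝ)} {x N : ℝ × ℝ → E3} {μ : ℝ × ℝ → ℝ} {p : ℝ × ℝ}

lemma abs_eq_mul (hS : SurfaceData U x N) (hμ : ContinuousOn μ U) (hμ0 : ∀ p ∈ U, μ p ≠ 0) :
    ∃ σ : ℝ, σ ^ 2 = 1 ∧ ∀ p ∈ U, |μ p| = σ * μ p := by
  rcases hS.conn_U.isPreconnected.eq_or_eq_neg_of_sq_eq hμ.abs hμ (fun p hp => by simp)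
    (fun hp => hμ0 _ hp) with h | h
  · exact ⟨1, by norm_num, fun p hp => by rw [one_mul]; exact h hp⟩
  · exact ⟨-1, by norm_num, fun p hp => by rw [neg_one_mul]; exact h hp⟩

lemma inCircularCone_of_grad (hS : SurfaceData U x N) (hμ : ∀ p ∈ U, DifferentiableAt ℝ μ p)
    (hμ0 : ∀ p ∈ U, μ p ≠ 0) {F : ℝ × ℝ → E3} {γ : ℝ} (hγ : γ ≠ 0)
    (hF : ∀ p ∈ U, ⟪F p, F p⟫_ℝ = γ ∧ ⟪F p, N p⟫_ℝ = 0 ∧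
      HasFDerivAt F (-γ • fderiv ℝ N p) p ∧
      ∀ z, fderiv ℝ μ p z • F p - (μ p * γ) • fderiv ℝ N p z = γ • fderiv ℝ x p z) :
    InCircularCone U x := by
  obtain ⟨p₀, hp₀⟩ := hS.conn_U.nonempty
  have hγ0 : 0 < γ := lt_of_le_of_ne ((hF p₀ hp₀).1 ▸ real_inner_self_nonneg) hγ.symm
  obtain ⟨σ, hσ, hσμ⟩ := hS.abs_eq_mul
    (fun p hp => (hμ p hp).continuousAt.continuousWithinAt) hμ0
  obtain ⟨Z, hZ⟩ := hS.exists_const (f := fun p => F p + γ • N p) fun p hp => by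
    have h1 := (hF p hp).2.2.1.add ((hS.differentiableAt_N hp).hasFDerivAt.const_smul γ)
    rwa [← add_smul, neg_add_cancel, zero_smul] at h1
  obtain ⟨C, hC⟩ := hS.exists_const (f := fun p => μ p • F p - γ • x p) fun p hp => by
    obtain ⟨-, -, h2, h3⟩ := hF p hp
    have h1 := ((hμ p hp).hasFDerivAt.smul h2).sub
      ((hS.differentiableAt_x hp).hasFDerivAt.const_smul γ)
    refine h1.congr_fderiv (ContinuousLinearMap.ext fun z => ?_)
    simp only [sub_apply, add_apply, smul_apply, ContinuousLinearMap.smulRight_apply, zero_apply,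
      ← h3 z]
    module
  have hx : ∀ p ∈ U, x p - (-γ⁻¹ • C) = (μ p * γ⁻¹) • F p := fun p hp => by
    have h1 : x p = γ⁻¹ • (μ p • F p - C) := by
      rw [← hC p hp, sub_sub_cancel, smul_smul, inv_mul_cancel₀ hγ, one_smul]
    rw [h1]
    module
  have hZZ : ⟪Z, Z⟫_ℝ = γ + γ ^ 2 := by
    obtain ⟨h1, h2, -⟩ := hF p₀ hp₀
    rw [← hZ p₀ hp₀]
    simp only [inner_add_left, inner_add_right, real_inner_smul_left, real_inner_smul_right,
      real_inner_comm (F p₀) (N p₀), h1, h2, hS.inner_N_self hp₀]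
    ring
  have hZF : ∀ p ∈ U, ⟪Z, F p⟫_ℝ = γ := fun p hp => by
    obtain ⟨h1, h2, -⟩ := hF p hp
    rw [← hZ p hp, inner_add_left, real_inner_smul_left, real_inner_comm, h1, real_inner_comm, h2]
    ring
  have hnZ : ‖Z‖ ^ 2 = γ + γ ^ 2 := by rw [← real_inner_self_eq_norm_sq, hZZ]
  have hnZ0 : 0 < ‖Z‖ := norm_pos_iff.2 fun h0 => by
    rw [h0, inner_zero_left] at hZZ
    linarith [sq_nonneg γ]
  have hσ1 : |σ| = 1 := by
    rw [← sq_eq_sq₀ (abs_nonneg σ) zero_le_one, sq_abs, hσ, one_pow]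
  refine inCircularCone_iff.2 ⟨Real.sqrt γ, -γ⁻¹ • C, (σ * ‖Z‖⁻¹) • Z,
    (Real.sqrt_pos.2 hγ0).ne', ?_, fun p hp => ?_⟩
  · rw [norm_smul, norm_mul, norm_inv, norm_norm, Real.norm_eq_abs, hσ1, one_mul,
      inv_mul_cancel₀ hnZ0.ne']
  · have h1 : ⟪(σ * ‖Z‖⁻¹) • Z, x p - (-γ⁻¹ • C)⟫_ℝ = |μ p| * ‖Z‖⁻¹ := by
      rw [hx p hp, real_inner_smul_left, real_inner_smul_right, hZF p hp, hσμ p hp]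
      field_simp
    rw [h1]
    refine ⟨mul_pos (abs_pos.2 (hμ0 p hp)) (inv_pos.2 hnZ0), ?_⟩
    rw [hx p hp, real_inner_smul_left, real_inner_smul_right, (hF p hp).1, mul_pow, sq_abs, inv_pow,
      hnZ, Real.sq_sqrt hγ0.le]
    field_simp

lemma inCircularCylinder_of_ruling (hS : SurfaceData U x N) {m : ℝ} (hm : m ≠ 0)
    (hl : ∀ p ∈ U, ∃ W ⊆ U, p ∈ W ∧ IsOpen W ∧ ∃ e, ∀ y ∈ W, IsRuling x N y m e) :
    InCircularCylinder U x := by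
  have hex : ∀ p, ∃ e, p ∈ U → IsRuling x N p m e := by
    intro p
    by_cases hp : p ∈ U
    · obtain ⟨W, -, hpW, -, e, h⟩ := hl p hp
      exact ⟨e, fun _ => h p hpW⟩
    · exact ⟨0, fun h => absurd h hp⟩
  choose e he using hex
  obtain ⟨p₀, hp₀⟩ := hS.conn_U.nonempty
  set w := e p₀
  have hw : ⟪w, w⟫_ℝ = 1 := (he p₀ hp₀).inner_self
  obtain ⟨G, hG⟩ := hS.exists_const (f := fun p => ⟪e p, w⟫_ℝ • e p) fun p hp => by
    obtain ⟨W, hWU, hpW, hW, v, h⟩ := hl p hp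
    refine (hasFDerivAt_const (⟪v, w⟫_ℝ • v) p).congr_of_eventuallyEq ?_
    filter_upwards [hW.mem_nhds hpW] with y hy
    exact (he y (hWU hy)).inner_smul_eq hS (hWU hy) (h y hy) w
  obtain rfl : w = G := by rw [← hG p₀ hp₀, hw, one_smul]
  have hwe : ∀ p ∈ U, ⟪e p, w⟫_ℝ • e p = w := hG
  have hwN : ∀ p ∈ U, ⟪w, N p⟫_ℝ = 0 := fun p hp => by
    rw [← hwe p hp, real_inner_smul_left, (he p hp).inner_N, mul_zero]
  have hdx : ∀ p ∈ U, ∀ z, fderiv ℝ x p z = ⟪w, fderiv ℝ x p z⟫_ℝ • w - m • fderiv ℝ N p z := by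
    intro p hp z
    have hk : ⟪e p, w⟫_ℝ ^ 2 = 1 := by
      have h1 := hw
      rw [← hwe p hp, real_inner_smul_left, real_inner_smul_right, (he p hp).inner_self] at h1
      linarith
    conv_lhs => rw [(he p hp).dx_eq z]
    congr 1
    rw [← hwe p hp, real_inner_smul_left, smul_smul, real_inner_comm]
    congr 1
    linear_combination (-⟪e p, fderiv ℝ x p z⟫_ℝ) * hk
  obtain ⟨c, hc⟩ := hS.exists_const (f := fun p => x p - ⟪w, x p⟫_ℝ • w + m • N p) fun p hp => by
    have hx := (hS.differentiableAt_x hp).hasFDerivAt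
    have h1 := (hx.sub (((innerSL ℝ w).hasFDerivAt.comp p hx).smul_const w)).add
      ((hS.differentiableAt_N hp).hasFDerivAt.const_smul m)
    refine h1.congr_fderiv (ContinuousLinearMap.ext fun z => ?_)
    have h2 := hdx p hp z
    simp only [sub_apply, add_apply, smul_apply, ContinuousLinearMap.smulRight_apply, zero_apply,
      ContinuousLinearMap.comp_apply, innerSL_apply_apply]
    nth_rewrite 1 [h2]
    module
  refine ⟨c, w, |m|, by rw [norm_eq_sqrt_real_inner, hw, Real.sqrt_one], abs_pos.2 hm,
    fun p hp => ?_⟩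
  have h1 : x p - c = ⟪w, x p⟫_ℝ • w - m • N p := by rw [← hc p hp]; module
  have h2 : ⟪x p - c, w⟫_ℝ = ⟪w, x p⟫_ℝ := by
    rw [h1, inner_sub_left, real_inner_smul_left, real_inner_smul_left, hw, real_inner_comm w,
      hwN p hp]
    ring
  rw [h2, h1, sub_sub_cancel_left, norm_neg, norm_smul, hS.unit_N p hp, mul_one, Real.norm_eq_abs]

lemma classification (hS : SurfaceData U x N)
    (hM : ∀ p ∈ U, ∀ t H, IsMeanCurvAt (nbi x N) (p, t) H → MaslovianAt (nbi x N) (p, t) H) :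
    InRoundSphere U x ∨ InCircularCylinder U x ∨ InCircularCone U x := by
  rcases hS.maslovian_dichotomy hM with hK | ⟨m, K, -, hK, h⟩
  swap
  · exact Or.inl (hS.inRoundSphere_of_const hK h)
  right
  have hm : ∀ p ∈ U, curvTrace x N p ≠ 0 := fun p hp => hS.maslovian_curvTrace_ne_zero hp (hM p hp)
  have hl := fun p (hp : p ∈ U) => hS.exists_ruling hm hK
    (fun p hp _ _ _ _ h => hS.maslovian_fderiv_curvTrace hp (hM p hp) h) hp
  have hμ0 : ∀ p ∈ U, (curvTrace x N p)⁻¹ ≠ 0 := fun p hp => inv_ne_zero (hm p hp)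
  have hμ : ∀ p ∈ U, DifferentiableAt ℝ (fun p => (curvTrace x N p)⁻¹) p := fun p hp =>
    (hS.differentiableAt_curvTrace hp).fun_inv (hm p hp)
  obtain ⟨F, γ, hF⟩ := hS.exists_grad hl
  by_cases hγ : γ = 0
  · left
    have hF0 : ∀ p ∈ U, F p = 0 := fun p hp => by
      have h1 := (hF p hp).1
      rwa [hγ, inner_self_eq_zero] at h1
    have hdμ : ∀ p ∈ U, fderiv ℝ (fun p => (curvTrace x N p)⁻¹) p = 0 := fun p hp =>
      ContinuousLinearMap.ext fun z => by
        rw [(hF p hp).2.2.2.1, hF0 p hp, inner_zero_left, zero_apply]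
    obtain ⟨m, hm'⟩ := hS.exists_const fun p hp => by
      have h1 := (hμ p hp).hasFDerivAt
      rwa [hdμ p hp] at h1
    obtain ⟨p₀, hp₀⟩ := hS.conn_U.nonempty
    refine hS.inCircularCylinder_of_ruling (m := m) (hm' p₀ hp₀ ▸ hμ0 p₀ hp₀) fun p hp => ?_
    obtain ⟨W, hWU, hpW, hSW, e, c, h⟩ := hl p hp
    have hc : c = 0 := by
      obtain ⟨h1, h2, -⟩ := h p hpW
      obtain ⟨z, hz⟩ := hS.exists_fderiv_eq hp (z := e p) (by rw [real_inner_comm, h1.inner_N])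
      have h3 := h2 z
      rw [hdμ p hp, hz, h1.inner_self, mul_one] at h3
      exact h3.symm
    obtain ⟨v, hv⟩ := hSW.exists_const (f := e) fun y hy => by
      refine (h y hy).2.2.congr_fderiv (ContinuousLinearMap.ext fun z => ?_)
      rw [smul_apply, hc, neg_zero, zero_smul, zero_apply]
    refine ⟨W, hWU, hpW, hSW.open_U, v, fun y hy => ?_⟩
    have h1 := (h y hy).1
    rwa [hv y hy, hm' y (hWU hy)] at h1
  · right
    exact hS.inCircularCone_of_grad hμ hμ0 hγ fun p hp =>
      ⟨(hF p hp).1, (hF p hp).2.1, (hF p hp).2.2.1, (hF p hp).2.2.2.2⟩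

end SurfaceData

end Classification

section Quadrics

namespace SurfaceData

variable {U : Set (ℝ × ℝ)} {x N : ℝ × ℝ → E3} {p : ℝ × ℝ} {m c w : E3} {b ε g : ℝ}

lemma hasFDerivAt_x_sub (hS : SurfaceData U x N) (hp : p ∈ U) (c : E3) :
    HasFDerivAt (fun y => x y - c) (fderiv ℝ x p) p :=
  (hS.differentiableAt_x hp).hasFDerivAt.sub_const c

lemma fderiv_of_affine (hS : SurfaceData U x N)
    (h : ∀ p ∈ U, (⟪m, x p - c⟫_ℝ + b) • N p = ε • (x p - c - (g * ⟪w, x p - c⟫_ℝ) • w))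
    (hp : p ∈ U) (v : ℝ × ℝ) :
    ⟪m, fderiv ℝ x p v⟫_ℝ • N p + (⟪m, x p - c⟫_ℝ + b) • fderiv ℝ N p v =
      ε • (fderiv ℝ x p v - (g * ⟪w, fderiv ℝ x p v⟫_ℝ) • w) := by
  have hy := hS.hasFDerivAt_x_sub hp c
  have h1 := (((hasFDerivAt_const m p).inner ℝ hy).add_const b).smul
    (hS.differentiableAt_N hp).hasFDerivAt
  have h2 := (hy.sub ((((hasFDerivAt_const w p).inner ℝ hy).const_mul g).smul_const w)).const_smul ε
  have h4 := congrArg (fun L => L v) ((h1.fderiv.symm.trans (hS.fderiv_congr h hp)).trans h2.fderiv)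
  simpa [add_comm, fderivInnerCLM_apply] using h4

lemma secondDeriv_of_affine (hS : SurfaceData U x N)
    (h : ∀ p ∈ U, (⟪m, x p - c⟫_ℝ + b) • N p = ε • (x p - c - (g * ⟪w, x p - c⟫_ℝ) • w))
    (hp : p ∈ U) (u v : ℝ × ℝ) :
    ⟪m, secondDeriv x p u v⟫_ℝ • N p + ⟪m, fderiv ℝ x p v⟫_ℝ • fderiv ℝ N p u +
        (⟪m, fderiv ℝ x p u⟫_ℝ • fderiv ℝ N p v +
          (⟪m, x p - c⟫_ℝ + b) • secondDeriv N p u v) =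
      ε • (secondDeriv x p u v - (g * ⟪w, secondDeriv x p u v⟫_ℝ) • w) := by
  have hy := hS.hasFDerivAt_x_sub hp c
  have hdx := (hS.differentiableAt_dx hp v).hasFDerivAt
  have h1 := ((((hasFDerivAt_const m p).inner ℝ hdx)).smul
    (hS.differentiableAt_N hp).hasFDerivAt).add
    ((((hasFDerivAt_const m p).inner ℝ hy).add_const b).smul
      (hS.differentiableAt_dN hp v).hasFDerivAt)
  have h2 := (hdx.sub
    ((((hasFDerivAt_const w p).inner ℝ hdx).const_mul g).smul_const w)).const_smul ε
  have h3 := hS.fderiv_congr (fun p hp => hS.fderiv_of_affine h hp v) hp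
  have h4 := congrArg (fun L => L u) ((h1.fderiv.symm.trans h3).trans h2.fderiv)
  simp only [add_apply, smul_apply, sub_apply,
    ContinuousLinearMap.smulRight_apply, ContinuousLinearMap.comp_apply,
    ContinuousLinearMap.prod_apply, fderivInnerCLM_apply, zero_apply, inner_zero_left,
    add_zero, smul_eq_mul] at h4
  simp only [secondDeriv]
  rw [← h4]
  abel

lemma mul_codazziForm_of_affine (hS : SurfaceData U x N)
    (h : ∀ p ∈ U, (⟪m, x p - c⟫_ℝ + b) • N p = ε • (x p - c - (g * ⟪w, x p - c⟫_ℝ) • w))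
    (hp : p ∈ U) (u v z : ℝ × ℝ) :
    (⟪m, x p - c⟫_ℝ + b) * codazziForm x N p u v z =
      -(⟪m, fderiv ℝ x p v⟫_ℝ * ⟪fderiv ℝ N p u, fderiv ℝ x p z⟫_ℝ +
        ⟪m, fderiv ℝ x p u⟫_ℝ * ⟪fderiv ℝ N p v, fderiv ℝ x p z⟫_ℝ +
        ⟪m, fderiv ℝ x p z⟫_ℝ * ⟪fderiv ℝ N p u, fderiv ℝ x p v⟫_ℝ) := by
  have h1 := congrArg (fun y => ⟪y, fderiv ℝ x p z⟫_ℝ) (hS.secondDeriv_of_affine h hp u v)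
  have h2 := congrArg (fun y => ⟪y, secondDeriv x p u v⟫_ℝ) (hS.fderiv_of_affine h hp z)
  simp only [inner_add_left, inner_sub_left, real_inner_smul_left, hS.normal_N p hp,
    hS.inner_N_secondDeriv_x hp] at h1 h2
  rw [codazziForm]
  rw [real_inner_comm (fderiv ℝ x p z) (secondDeriv x p u v)] at h1
  rw [real_inner_comm (fderiv ℝ N p z)]
  linear_combination h1 - h2

lemma inner_fderiv_of_affine (hS : SurfaceData U x N)
    (h : ∀ p ∈ U, (⟪m, x p - c⟫_ℝ + b) • N p = ε • (x p - c - (g * ⟪w, x p - c⟫_ℝ) • w))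
    (hp : p ∈ U) (u v : ℝ × ℝ) :
    (⟪m, x p - c⟫_ℝ + b) * ⟪fderiv ℝ N p u, fderiv ℝ x p v⟫_ℝ =
      ε * (⟪fderiv ℝ x p u, fderiv ℝ x p v⟫_ℝ -
        g * ⟪w, fderiv ℝ x p u⟫_ℝ * ⟪w, fderiv ℝ x p v⟫_ℝ) := by
  have h2 := congrArg (fun y => ⟪y, fderiv ℝ x p v⟫_ℝ) (hS.fderiv_of_affine h hp u)
  simp only [inner_add_left, inner_sub_left, real_inner_smul_left, hS.normal_N p hp] at h2
  linear_combination h2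

lemma maslovianAt_of_codazziForm_eq_zero (hS : SurfaceData U x N) (hp : p ∈ U) {ξ₁ ξ₂ : ℝ × ℝ}
    {κ₁ κ₂ : ℝ} (h : PrincipalFrame x N p ξ₁ ξ₂ κ₁ κ₂) (t : ℝ)
    (hT₁ : codazziForm x N p ξ₁ ξ₁ ξ₁ = 0) (hT₃ : codazziForm x N p ξ₁ ξ₂ ξ₂ = 0)
    (hT₄ : codazziForm x N p ξ₂ ξ₂ ξ₂ = 0) (hT₂ : κ₂ = 0 ∨ codazziForm x N p ξ₁ ξ₁ ξ₂ = 0)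
    (hκ : 0 ≤ κ₁ * κ₂) (hκ' : κ₁ ≠ 0 ∨ κ₂ ≠ 0) :
    ∀ H, IsMeanCurvAt (nbi x N) (p, t) H → MaslovianAt (nbi x N) (p, t) H := by
  refine (hS.forall_maslovianAt_nbi_iff hp h t rfl rfl rfl rfl rfl rfl rfl rfl rfl).2
    ⟨.inr (.inr ?_), 0, ?_⟩
  · intro h0
    have h1 : 0 < (1 + t ^ 2 * κ₁ ^ 2)⁻¹ := by positivity
    have h2 : 0 < (1 + t ^ 2 * κ₂ ^ 2)⁻¹ := by positivity
    set r₁ := (1 + t ^ 2 * κ₁ ^ 2)⁻¹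
    set r₂ := (1 + t ^ 2 * κ₂ ^ 2)⁻¹
    have h3 : r₁ * κ₁ + r₂ * κ₂ = 0 := by linarith
    have h4 : r₁ * κ₁ ^ 2 + r₂ * (κ₁ * κ₂) = 0 := by linear_combination κ₁ * h3
    have h5 : r₁ * (κ₁ * κ₂) + r₂ * κ₂ ^ 2 = 0 := by linear_combination κ₂ * h3
    have h6 := mul_nonneg h1.le hκ
    have h7 := mul_nonneg h2.le hκ
    rcases hκ' with h8 | h8
    · have : 0 < r₁ * κ₁ ^ 2 := by positivity
      linarith
    · have : 0 < r₂ * κ₂ ^ 2 := by positivity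
      linarith
  · rw [hT₁, hT₃, hT₄]
    rcases hT₂ with h0 | h0 <;> rw [h0] <;> refine ⟨?_, ?_, ?_⟩ <;> ring

/-- The gradient direction `x - c - g ⟪w, x - c⟫ w` of a quadric of revolution is normal. -/
lemma exists_smul_normal_of_quadric (hS : SurfaceData U x N) {C : ℝ}
    (hq : ∀ p ∈ U, ⟪x p - c, x p - c⟫_ℝ - g * ⟪w, x p - c⟫_ℝ ^ 2 = C)
    (hφ : ∀ p ∈ U, 0 < ⟪m, x p - c⟫_ℝ + b)
    (hφ2 : ∀ p ∈ U, ⟪x p - c - (g * ⟪w, x p - c⟫_ℝ) • w,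
      x p - c - (g * ⟪w, x p - c⟫_ℝ) • w⟫_ℝ = (⟪m, x p - c⟫_ℝ + b) ^ 2) :
    ∃ ε : ℝ, ε ^ 2 = 1 ∧
      ∀ p ∈ U, (⟪m, x p - c⟫_ℝ + b) • N p = ε • (x p - c - (g * ⟪w, x p - c⟫_ℝ) • w) := by
  set V : ℝ × ℝ → E3 := fun p => x p - c - (g * ⟪w, x p - c⟫_ℝ) • w
  have hV : ∀ p ∈ U, ∀ z, ⟪V p, fderiv ℝ x p z⟫_ℝ = 0 := by
    intro p hp z
    have hy := hS.hasFDerivAt_x_sub hp c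
    have h1 := (hy.inner ℝ hy).sub ((((hasFDerivAt_const w p).inner ℝ hy).pow 2).const_mul g)
    have h2 := congrArg (fun L => L z) (h1.fderiv.symm.trans (hS.fderiv_congr hq hp))
    simp [fderivInnerCLM_apply] at h2
    simp only [V]
    rw [inner_sub_left, real_inner_smul_left]
    rw [real_inner_comm (x p - c) (fderiv ℝ x p z)] at h2
    linear_combination h2 / 2
  have hVN : ∀ p ∈ U, V p = ⟪N p, V p⟫_ℝ • N p := by
    intro p hp
    rw [← sub_eq_zero]
    refine hS.ext_inner_tangent hp ?_ (inner_zero_left _) fun z => ?_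
    · rw [inner_sub_left, real_inner_smul_left, hS.inner_N_self hp, real_inner_comm]
      ring
    · rw [inner_sub_left, real_inner_smul_left, hS.normal_N p hp, hV p hp, inner_zero_left]
      ring
  have hsq : ∀ p ∈ U, ⟪N p, V p⟫_ℝ ^ 2 = (⟪m, x p - c⟫_ℝ + b) ^ 2 := by
    intro p hp
    rw [← hφ2 p hp]
    change _ = ⟪V p, V p⟫_ℝ
    conv_rhs => rw [hVN p hp]
    rw [real_inner_smul_left, real_inner_smul_right, hS.inner_N_self hp]
    ring
  obtain ⟨ε, hε, h⟩ := hS.abs_eq_mul (μ := fun p => ⟪N p, V p⟫_ℝ)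
    (by
      have h1 := hS.smooth_x.continuousOn
      have h2 := hS.smooth_N.continuousOn
      fun_prop)
    (fun p hp h0 => by
      have := hsq p hp
      rw [h0] at this
      have := hφ p hp
      nlinarith)
  refine ⟨ε, hε, fun p hp => ?_⟩
  have h1 : ⟪m, x p - c⟫_ℝ + b = ε * ⟪N p, V p⟫_ℝ := by
    rw [← h p hp, ← abs_of_pos (hφ p hp), abs_eq_abs, ← sq_eq_sq_iff_eq_or_eq_neg, hsq p hp]
  rw [h1]
  conv_rhs => rw [show x p - c - (g * ⟪w, x p - c⟫_ℝ) • w = V p from rfl, hVN p hp]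
  rw [smul_smul]

/-- Round spheres (`g = 0`) and circular cylinders (`g = 1`). -/
lemma maslovianAt_of_norm_eq (hS : SurfaceData U x N) (hw : ‖w‖ = 1) (hg : g = 0 ∨ g = 1)
    {ρ : ℝ} (hρ : 0 < ρ) (h : ∀ p ∈ U, ‖x p - c - (g * ⟪w, x p - c⟫_ℝ) • w‖ = ρ)
    (hp : p ∈ U) (t : ℝ) :
    ∀ H, IsMeanCurvAt (nbi x N) (p, t) H → MaslovianAt (nbi x N) (p, t) H := by
  have hww : ⟪w, w⟫_ℝ = 1 := by rw [real_inner_self_eq_norm_sq, hw, one_pow]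
  have hgg : g * g = g := by rcases hg with rfl | rfl <;> norm_num
  have hg0 : 0 ≤ g := by rcases hg with rfl | rfl <;> norm_num
  have hg1 : g ≤ 1 := by rcases hg with rfl | rfl <;> norm_num
  have hV : ∀ p ∈ U, ⟪x p - c - (g * ⟪w, x p - c⟫_ℝ) • w,
      x p - c - (g * ⟪w, x p - c⟫_ℝ) • w⟫_ℝ = ρ ^ 2 := fun p hp => by
    rw [real_inner_self_eq_norm_sq, h p hp]
  obtain ⟨ε, hε, hN⟩ := hS.exists_smul_normal_of_quadric (m := 0) (b := ρ) (g := g) (w := w)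
    (c := c) (C := ρ ^ 2) (fun p hp => by
      rw [← hV p hp]
      generalize x p - c = y
      simp only [inner_sub_left, inner_sub_right, real_inner_smul_left, real_inner_smul_right, hww,
        real_inner_comm w y]
      linear_combination (-⟪w, y⟫_ℝ ^ 2) * hgg)
    (fun p _ => by rwa [inner_zero_left, zero_add])
    (fun p hp => by rw [hV p hp, inner_zero_left, zero_add])
  have hT : ∀ u v z, codazziForm x N p u v z = 0 := fun u v z => by
    have h1 := hS.mul_codazziForm_of_affine hN hp u v z
    simpa [hρ.ne'] using h1
  have hII : ∀ u v, ρ * ⟪fderiv ℝ N p u, fderiv ℝ x p v⟫_ℝ =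
      ε * (⟪fderiv ℝ x p u, fderiv ℝ x p v⟫_ℝ -
        g * ⟪w, fderiv ℝ x p u⟫_ℝ * ⟪w, fderiv ℝ x p v⟫_ℝ) := fun u v => by
    have h1 := hS.inner_fderiv_of_affine hN hp u v
    rwa [inner_zero_left, zero_add] at h1
  obtain ⟨ξ₁, ξ₂, κ₁, κ₂, hF⟩ := hS.exists_principalFrame hp
  have h11 := hII ξ₁ ξ₁
  have h12 := hII ξ₁ ξ₂
  have h22 := hII ξ₂ ξ₂
  rw [hF.eig₁, real_inner_smul_left, hF.norm₁] at h11
  rw [hF.eig₁, real_inner_smul_left, hF.orth] at h12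
  rw [hF.eig₂, real_inner_smul_left, hF.norm₂] at h22
  have hb₁ : ⟪w, fderiv ℝ x p ξ₁⟫_ℝ ^ 2 ≤ 1 := by
    have := real_inner_mul_inner_self_le w (fderiv ℝ x p ξ₁)
    rw [hww, hF.norm₁] at this
    linarith
  have hb₂ : ⟪w, fderiv ℝ x p ξ₂⟫_ℝ ^ 2 ≤ 1 := by
    have := real_inner_mul_inner_self_le w (fderiv ℝ x p ξ₂)
    rw [hww, hF.norm₂] at this
    linarith
  generalize ⟪w, fderiv ℝ x p ξ₁⟫_ℝ = w₁ at *
  generalize ⟪w, fderiv ℝ x p ξ₂⟫_ℝ = w₂ at *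
  have h12' : g * w₁ * w₂ = 0 := by linear_combination ε * h12 - g * w₁ * w₂ * hε
  refine hS.maslovianAt_of_codazziForm_eq_zero hp hF t (hT _ _ _) (hT _ _ _) (hT _ _ _)
    (.inr (hT _ _ _)) ?_ ?_
  · have h1 : 0 ≤ (1 - g * w₁ ^ 2) * (1 - g * w₂ ^ 2) := by
      apply mul_nonneg <;> nlinarith
    have h2 : ρ ^ 2 * (κ₁ * κ₂) = (1 - g * w₁ ^ 2) * (1 - g * w₂ ^ 2) := by
      linear_combination (-ρ * κ₂) * h11 + (ε * (1 - g * w₁ * w₁)) * h22 +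
        (1 - g * w₁ ^ 2) * (1 - g * w₂ ^ 2) * hε
    rw [← h2] at h1
    exact nonneg_of_mul_nonneg_right h1 (by positivity)
  · by_contra! h0
    rw [h0.1] at h11
    rw [h0.2] at h22
    have h3 : g * w₁ ^ 2 = 1 := by linear_combination ε * h11 + (1 - g * w₁ ^ 2) * hε
    have h4 : g * w₂ ^ 2 = 1 := by linear_combination ε * h22 + (1 - g * w₂ ^ 2) * hε
    have h5 : (g * w₁ ^ 2) * (g * w₂ ^ 2) = 0 := by linear_combination (g * w₁ * w₂) * h12'
    rw [h3, h4] at h5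
    norm_num at h5

lemma maslovianAt_of_cone (hS : SurfaceData U x N) {r : ℝ} (hr : r ≠ 0) (hw : ‖w‖ = 1)
    (h0 : ∀ p ∈ U, 0 < ⟪w, x p - c⟫_ℝ)
    (h : ∀ p ∈ U, (1 + r ^ 2) * ⟪w, x p - c⟫_ℝ ^ 2 = ⟪x p - c, x p - c⟫_ℝ)
    (hp : p ∈ U) (t : ℝ) :
    ∀ H, IsMeanCurvAt (nbi x N) (p, t) H → MaslovianAt (nbi x N) (p, t) H := by
  have hww : ⟪w, w⟫_ℝ = 1 := by rw [real_inner_self_eq_norm_sq, hw, one_pow]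
  set g := 1 + r ^ 2
  set s := √((1 + r ^ 2) * r ^ 2)
  have hs : 0 < s := Real.sqrt_pos.2 (by positivity)
  have hs2 : s ^ 2 = (1 + r ^ 2) * r ^ 2 := Real.sq_sqrt (by positivity)
  obtain ⟨ε, hε, hN⟩ := hS.exists_smul_normal_of_quadric (m := s • w) (b := 0) (g := g) (w := w)
    (c := c) (C := 0) (fun p hp => by rw [← h p hp, sub_self])
    (fun p hp => by
      rw [real_inner_smul_left, add_zero]
      exact mul_pos hs (h0 p hp))
    (fun p hp => by
      have h1 := h p hp
      generalize x p - c = y at *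
      simp only [inner_sub_left, inner_sub_right, real_inner_smul_left, real_inner_smul_right, hww,
        real_inner_comm w y]
      rw [← h1]
      linear_combination (-⟪w, y⟫_ℝ ^ 2) * hs2)
  have hd := hS.fderiv_of_affine hN hp
  have hT := hS.mul_codazziForm_of_affine hN hp
  have hII := hS.inner_fderiv_of_affine hN hp
  simp only [real_inner_smul_left, add_zero] at hd hT hII
  have hwy := h0 p hp
  have hφ : s * ⟪w, x p - c⟫_ℝ ≠ 0 := (mul_pos hs hwy).ne'
  have hNp := hN p hp
  rw [real_inner_smul_left, add_zero] at hNp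
  obtain ⟨z, hz⟩ := hS.exists_fderiv_eq hp (z := x p - c) (by
    have h1 := congrArg (fun v => ⟪v, x p - c⟫_ℝ) hNp
    simp only [real_inner_smul_left, inner_sub_left (x p - c)] at h1
    rw [← h p hp] at h1
    refine (mul_eq_zero_iff_left hφ).1 (h1.trans ?_)
    ring)
  have hdz : fderiv ℝ N p z = 0 := by
    have h1 := hd z
    rw [hz, hNp, add_eq_left] at h1
    exact (smul_eq_zero_iff_right hφ).1 h1
  have key : ∀ {ξ₁ ξ₂ : ℝ × ℝ} {κ₁ κ₂ : ℝ}, PrincipalFrame x N p ξ₁ ξ₂ κ₁ κ₂ → κ₁ ≠ 0 →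
      ∀ H, IsMeanCurvAt (nbi x N) (p, t) H → MaslovianAt (nbi x N) (p, t) H := by
    intro ξ₁ ξ₂ κ₁ κ₂ hF hκ
    have horth : ⟪x p - c, fderiv ℝ x p ξ₁⟫_ℝ = 0 := by
      have h1 := hS.inner_dN_dx_comm hp z ξ₁
      rw [hdz, inner_zero_left, hF.eig₁, real_inner_smul_left, hz, zero_eq_mul] at h1
      rw [real_inner_comm]
      exact h1.resolve_left (neg_ne_zero.2 hκ)
    have hw₁ : ⟪w, fderiv ℝ x p ξ₁⟫_ℝ = 0 := by
      have h1 := congrArg (fun v => ⟪v, fderiv ℝ x p ξ₁⟫_ℝ) hNp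
      simp only [real_inner_smul_left, inner_sub_left (x p - c), horth, hS.normal_N p hp] at h1
      have h2 : ε ≠ 0 := by
        rintro rfl
        norm_num at hε
      have h3 : g ≠ 0 := by positivity
      have h4 : ε * (g * ⟪w, x p - c⟫_ℝ) * ⟪w, fderiv ℝ x p ξ₁⟫_ℝ = 0 := by linarith
      exact (mul_eq_zero_iff_left (by positivity)).1 h4
    have hκ₂ : κ₂ = 0 := by
      by_contra hκ₂
      have h1 := hS.inner_dN_dx_comm hp z ξ₂
      rw [hdz, inner_zero_left, hF.eig₂, real_inner_smul_left, hz, zero_eq_mul] at h1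
      have h2 := h1.resolve_left (neg_ne_zero.2 hκ₂)
      rw [real_inner_comm] at h2
      have h3 := hS.ext_inner_tangent hp (v := x p - c) (w := 0)
        (by rw [← hz, real_inner_comm, hS.normal_N p hp]) (inner_zero_left _) fun v => by
          rw [hF.eq_add hS hp v]
          simp [inner_add_right, real_inner_smul_right, horth, h2]
      rw [h3, inner_zero_right] at hwy
      exact hwy.false
    have hd₂ : fderiv ℝ N p ξ₂ = 0 := by rw [hF.eig₂, hκ₂, neg_zero, zero_smul]
    refine hS.maslovianAt_of_codazziForm_eq_zero hp hF t ?_ ?_ ?_ (.inl hκ₂)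
      (by rw [hκ₂, mul_zero]) (.inl hκ)
    · have h1 := hT ξ₁ ξ₁ ξ₁
      rw [hw₁] at h1
      exact (mul_eq_zero_iff_left hφ).1 (h1.trans (by ring))
    · have h1 := hT ξ₁ ξ₂ ξ₂
      rw [hw₁, hd₂, hF.eig₁, real_inner_smul_left, hF.orth, inner_zero_left] at h1
      exact (mul_eq_zero_iff_left hφ).1 (h1.trans (by ring))
    · have h1 := hT ξ₂ ξ₂ ξ₂
      rw [hd₂, inner_zero_left] at h1
      exact (mul_eq_zero_iff_left hφ).1 (h1.trans (by ring))
  obtain ⟨ξ₁, ξ₂, κ₁, κ₂, hF⟩ := hS.exists_principalFrame hp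
  by_cases hκ₁ : κ₁ = 0
  · by_cases hκ₂ : κ₂ = 0
    · exfalso
      have h11 := hII ξ₁ ξ₁
      have h12 := hII ξ₁ ξ₂
      have h22 := hII ξ₂ ξ₂
      rw [hF.eig₁, real_inner_smul_left, hκ₁, hF.norm₁] at h11
      rw [hF.eig₁, real_inner_smul_left, hκ₁, hF.orth] at h12
      rw [hF.eig₂, real_inner_smul_left, hκ₂, hF.norm₂] at h22
      generalize ⟪w, fderiv ℝ x p ξ₁⟫_ℝ = w₁ at *
      generalize ⟪w, fderiv ℝ x p ξ₂⟫_ℝ = w₂ at *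
      have h3 : g * w₁ ^ 2 = 1 := by linear_combination ε * h11 + (1 - g * w₁ ^ 2) * hε
      have h4 : g * w₂ ^ 2 = 1 := by linear_combination ε * h22 + (1 - g * w₂ ^ 2) * hε
      have h12' : g * w₁ * w₂ = 0 := by linear_combination ε * h12 - g * w₁ * w₂ * hε
      have h5 : (g * w₁ ^ 2) * (g * w₂ ^ 2) = 0 := by linear_combination (g * w₁ * w₂) * h12'
      rw [h3, h4] at h5
      norm_num at h5
    · exact key ⟨hF.norm₂, hF.norm₁, by rw [real_inner_comm, hF.orth], hF.eig₂, hF.eig₁⟩ hκ₂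
  · exact key hF hκ₁

lemma lagrangianAt_nbi (hS : SurfaceData U x N) {q : W3} (hq : q.1 ∈ U) :
    LagrangianAt (nbi x N) q := by
  obtain ⟨_, _, _, _, hF⟩ := hS.exists_principalFrame hq
  obtain ⟨_, hL⟩ := hS.exists_lagrFrame hq hF q.2
  exact hL.lagrangianAt

end SurfaceData

end Quadrics

/-- A surface in Euclidean 3-space has Maslovian normal bundle if and only
if it is a part of a round sphere, a circular cylinder, or a circular cone. -/
theorem maslovian_normal_bundle_iff (U : Set (ℝ × ℝ)) (x N : ℝ × ℝ → E3)
    (hS : SurfaceData U x N) :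
    ((∀ q : W3, q.1 ∈ U → LagrangianAt (nbi x N) q) ∧
      ∀ q : W3, q.1 ∈ U → ∀ Hq : V6, IsMeanCurvAt (nbi x N) q Hq →
        MaslovianAt (nbi x N) q Hq) ↔
      (InRoundSphere U x ∨ InCircularCylinder U x ∨ InCircularCone U x) := by
  refine ⟨fun h => hS.classification fun p hp t => h.2 (p, t) hp, fun h =>
    ⟨fun _ => hS.lagrangianAt_nbi, fun q hq => ?_⟩⟩
  rcases h with ⟨c, ρ, hρ, h⟩ | ⟨c, w, ρ, hw, hρ, h⟩ | h
  · exact hS.maslovianAt_of_norm_eq (w := EuclideanSpace.single 0 1) (g := 0) (c := c) (by simp)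
      (.inl rfl) hρ (fun p hp => by rw [zero_mul, zero_smul, sub_zero, h p hp]) hq q.2
  · exact hS.maslovianAt_of_norm_eq (g := 1) (c := c) hw (.inr rfl) hρ
      (fun p hp => by rw [one_mul, real_inner_comm, h p hp]) hq q.2
  · obtain ⟨r, c, w, hr, hw, h⟩ := inCircularCone_iff.1 h
    exact hS.maslovianAt_of_cone hr hw (fun p hp => (h p hp).1) (fun p hp => (h p hp).2) hq q.2
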